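/- Propagation of logarithmic regularity for the transport equation (smooth setting): let d ≥ 1, p > 1, T > 0. There exists a constant C = C(p,d) > 0 such that the following holds. Let b : [0,T] × 𝕋^d → ℝ^d be a smooth vector field with div b(t,·) = 0 for every t, and let θ : [0,T] × 𝕋^d → ℝ be a smooth solution of ∂_t θ + b·∇θ = 0 with initial datum θ₀ = θ(0,·). Then for every t ∈ [0,T], [θ(t,·)]_{H^{log,p}} ≤ C ( ( ∫₀ᵗ ‖∇b(s,·)‖_{L^p(𝕋^d)} ds )^{p/2} ‖θ₀‖_{L^∞(𝕋^d)} + [θ₀]_{H^{log,p}} ). -/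

import Mathlib

open MeasureTheory ENNReal

noncomputable section

/-- The fundamental domain `[0,1)^d` of the torus `𝕋^d = ℝ^d/ℤ^d`. -/
def box (d : ℕ) : Set (Fin d → ℝ) := Set.univ.pi fun _ => Set.Ico (0:ℝ) 1

/-- A function on `ℝ^d` is ℤ^d-periodic, i.e. it descends to the torus `𝕋^d`. -/
def IsPeriodic {d : ℕ} {E : Type*} (f : (Fin d → ℝ) → E) : Prop :=
  ∀ (x : Fin d → ℝ) (k : Fin d → ℤ), f (x + fun i => (k i : ℝ)) = f x

/-- Euclidean norm on `ℝ^d`. -/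
def eNorm {d : ℕ} (h : Fin d → ℝ) : ℝ := Real.sqrt (∑ i, h i ^ 2)

/-- Geodesic distance on the torus `𝕋^d`, expressed for (representatives in) `ℝ^d`. -/
def torusDist {d : ℕ} (x y : Fin d → ℝ) : ℝ :=
  ⨅ k : Fin d → ℤ, eNorm (x - y + fun i => (k i : ℝ))
/-- The squared seminorm `[f]²_{H^{log,α}}` on the torus, for periodic `f : ℝ^d → ℝ`,
as a value in `[0,∞]`. -/
def logSeminormSqB (d : ℕ) (α : ℝ) (f : (Fin d → ℝ) → ℝ) : ℝ≥0∞ :=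
  ∫⁻ h in {h : Fin d → ℝ | eNorm h < 1/3}, ∫⁻ x in box d,
    ENNReal.ofReal (|f (x + h) - f x| ^ 2 *
      (eNorm h ^ (-(d:ℝ)) * Real.log (1 / eNorm h) ^ (α - 1))) ∂volume ∂volume

/-- The seminorm `[f]_{H^{log,α}}`, as a value in `[0,∞]`. -/
def logSeminormB (d : ℕ) (α : ℝ) (f : (Fin d → ℝ) → ℝ) : ℝ≥0∞ :=
  logSeminormSqB d α f ^ (1/2 : ℝ)

/-- The Hardy-Littlewood maximal function on `ℝ^d` over sup-norm balls of radius at most one. -/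
def maxFn {d : ℕ} (f : (Fin d → ℝ) → ℝ≥0∞) (x : Fin d → ℝ) : ℝ≥0∞ :=
  ⨆ r ∈ Set.Ioc (0:ℝ) 1, (ENNReal.ofReal ((2 * r) ^ d))⁻¹ * ∫⁻ y in Metric.ball x r, f y

lemma lt_maxFn_iff {d : ℕ} {f : (Fin d → ℝ) → ℝ≥0∞} {x : Fin d → ℝ} {c : ℝ≥0∞} :
    c < maxFn f x ↔ ∃ r ∈ Set.Ioc (0:ℝ) 1,
      c * ENNReal.ofReal ((2 * r) ^ d) < ∫⁻ y in Metric.ball x r, f y := by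
  unfold maxFn
  simp only [lt_iSup_iff, exists_prop]
  refine exists_congr fun r => and_congr_right fun hr => ?_
  have h0 : 0 < (2 * r) ^ d := by have := hr.1; positivity
  rw [mul_comm, ← div_eq_mul_inv, ENNReal.lt_div_iff_mul_lt] <;> left
  · simpa using h0
  · simp

lemma lintegral_ball_le_maxFn {d : ℕ} (f : (Fin d → ℝ) → ℝ≥0∞) (x : Fin d → ℝ) {r : ℝ}
    (hr : r ∈ Set.Ioc (0:ℝ) 1) :
    ∫⁻ y in Metric.ball x r, f y ≤ ENNReal.ofReal ((2 * r) ^ d) * maxFn f x := by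
  by_contra! h
  have := lt_maxFn_iff.2 ⟨r, hr, by rwa [mul_comm] at h⟩
  exact lt_irrefl _ this

lemma measurableSet_lt_maxFn {d : ℕ} (f : (Fin d → ℝ) → ℝ≥0∞) (c : ℝ≥0∞) :
    MeasurableSet {x | c < maxFn f x} := by
  refine IsOpen.measurableSet (isOpen_iff_mem_nhds.2 fun x hx => ?_)
  obtain ⟨r, hr, h⟩ := lt_maxFn_iff.1 hx
  have hU : Metric.ball x r = ⋃ n : ℕ, Metric.ball x (r - 1 / ((n : ℝ) + 1)) := by
    ext y
    simp only [Metric.mem_ball, Set.mem_iUnion]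
    constructor
    · intro hy
      obtain ⟨n, hn⟩ := exists_nat_one_div_lt (sub_pos.2 hy)
      exact ⟨n, by linarith⟩
    · rintro ⟨n, hn⟩
      have : 0 < 1 / ((n : ℝ) + 1) := by positivity
      linarith
  have hm : Monotone fun n : ℕ => Metric.ball x (r - 1 / ((n : ℝ) + 1)) := by
    intro m n hmn
    apply Metric.ball_subset_ball
    have : 1 / ((n : ℝ) + 1) ≤ 1 / ((m : ℝ) + 1) := by
      apply one_div_le_one_div_of_le (by positivity)
      have : (m : ℝ) ≤ n := by exact_mod_cast hmn
      linarith
    linarith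
  rw [hU, setLIntegral_iUnion_of_directed _ hm.directed_le, lt_iSup_iff] at h
  obtain ⟨n, hn⟩ := h
  have hpos : 0 < 1 / ((n : ℝ) + 1) := by positivity
  filter_upwards [Metric.ball_mem_nhds x hpos] with y hy
  refine lt_maxFn_iff.2 ⟨r, hr, hn.trans_le (lintegral_mono_set ?_)⟩
  apply Metric.ball_subset_ball'
  rw [Metric.mem_ball, dist_comm] at hy
  linarith

lemma measurable_maxFn {d : ℕ} (f : (Fin d → ℝ) → ℝ≥0∞) : Measurable (maxFn f) :=
  measurable_of_Ioi fun c => measurableSet_lt_maxFn f c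

lemma maxFn_le_of_le {d : ℕ} {f : (Fin d → ℝ) → ℝ≥0∞} {L : ℝ≥0∞} (hf : ∀ x, f x ≤ L)
    (x : Fin d → ℝ) : maxFn f x ≤ L := by
  by_contra! h
  obtain ⟨r, hr, h⟩ := lt_maxFn_iff.1 h
  refine absurd h (not_lt.2 ?_)
  calc ∫⁻ y in Metric.ball x r, f y ≤ ∫⁻ y in Metric.ball x r, L := lintegral_mono fun y => hf y
    _ = L * ENNReal.ofReal ((2 * r) ^ d) := by
      rw [setLIntegral_const, Real.volume_pi_ball _ hr.1, Fintype.card_fin]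

lemma maxFn_congr {d : ℕ} {f g : (Fin d → ℝ) → ℝ≥0∞} {x : Fin d → ℝ}
    (h : ∀ y ∈ Metric.ball x 1, f y = g y) : maxFn f x = maxFn g x := by
  unfold maxFn
  refine iSup_congr fun r => iSup_congr fun hr => ?_
  congr 1
  exact setLIntegral_congr_fun Metric.isOpen_ball.measurableSet
    fun y hy => h y (Metric.ball_subset_ball hr.2 hy)

/-- Weak type `(1,1)` estimate. -/
lemma mul_volume_lt_maxFn_le {d : ℕ} (f : (Fin d → ℝ) → ℝ≥0∞) (c : ℝ≥0∞) :
    c * volume {x | c < maxFn f x} ≤ 4 ^ d * ∫⁻ x, f x := by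
  have hex : ∀ x, ∃ r : ℝ, c < maxFn f x → r ∈ Set.Ioc (0:ℝ) 1 ∧
      c * ENNReal.ofReal ((2 * r) ^ d) < ∫⁻ y in Metric.ball x r, f y := by
    intro x
    by_cases hx : c < maxFn f x
    · obtain ⟨r, hr⟩ := lt_maxFn_iff.1 hx
      exact ⟨r, fun _ => hr⟩
    · exact ⟨0, fun h => absurd h hx⟩
  choose r hr using hex
  obtain ⟨u, hut, hdisj, hcov⟩ := Vitali.exists_disjoint_subfamily_covering_enlargement_closedBall
    {x | c < maxFn f x} (fun x => x) r 1 (fun a ha => (hr a ha).1.2) 4 (by norm_num)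
  have hucount : u.Countable := by
    refine hdisj.countable_of_nonempty_interior fun a ha => ?_
    exact ⟨a, Metric.ball_subset_interior_closedBall (Metric.mem_ball_self (hr a (hut ha)).1.1)⟩
  have hsub : {x | c < maxFn f x} ⊆ ⋃ b ∈ u, Metric.closedBall b (4 * r b) := by
    intro x hx
    obtain ⟨b, hb, hxb⟩ := hcov x hx
    exact Set.mem_biUnion hb (hxb (Metric.mem_closedBall_self (hr x hx).1.1.le))
  have := hucount.to_subtype
  calc c * volume {x | c < maxFn f x}
      ≤ c * ∑' b : u, volume (Metric.closedBall (b : Fin d → ℝ) (4 * r b)) := by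
        gcongr
        exact (measure_mono hsub).trans (measure_biUnion_le _ hucount _)
    _ = ∑' b : u, c * volume (Metric.closedBall (b : Fin d → ℝ) (4 * r b)) :=
        ENNReal.tsum_mul_left.symm
    _ ≤ ∑' b : u, 4 ^ d * ∫⁻ y in Metric.ball (b : Fin d → ℝ) (r b), f y := by
        refine ENNReal.tsum_le_tsum fun b => ?_
        have hb := hr b (hut b.2)
        rw [Real.volume_pi_closedBall _ (by linarith [hb.1.1]), Fintype.card_fin]
        have : ENNReal.ofReal ((2 * (4 * r b)) ^ d) = 4 ^ d * ENNReal.ofReal ((2 * r b) ^ d) := by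
          rw [show (2 * (4 * r b)) ^ d = 4 ^ d * (2 * r b) ^ d by rw [← mul_pow]; ring,
            ENNReal.ofReal_mul (by positivity), ENNReal.ofReal_pow (by norm_num)]
          norm_num
        rw [this, mul_left_comm]
        gcongr
        exact hb.2.le
    _ = 4 ^ d * ∫⁻ y in ⋃ b : u, Metric.ball (b : Fin d → ℝ) (r b), f y := by
        rw [ENNReal.tsum_mul_left, lintegral_iUnion (fun b => Metric.isOpen_ball.measurableSet)]
        intro a b hab
        exact (hdisj a.2 b.2 (fun h => hab (Subtype.ext h))).mono Metric.ball_subset_closedBall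
          Metric.ball_subset_closedBall
    _ ≤ 4 ^ d * ∫⁻ x, f x := by gcongr; exact Measure.restrict_le_self

lemma maxFn_le_maxFn_indicator_add {d : ℕ} {f : (Fin d → ℝ) → ℝ≥0∞} (hf : Measurable f)
    (c : ℝ≥0∞) (x : Fin d → ℝ) :
    maxFn f x ≤ maxFn ({x | c < f x}.indicator f) x + c := by
  refine iSup₂_le fun r hr => ?_
  have h0 : 0 < (2 * r) ^ d := by have := hr.1; positivity
  have hm : MeasurableSet {x | c < f x} := measurableSet_lt measurable_const hf
  have h1 : ∫⁻ y in Metric.ball x r, f y ≤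
      (∫⁻ y in Metric.ball x r, {x | c < f x}.indicator f y) + c * ENNReal.ofReal ((2 * r) ^ d) := by
    have hv := Real.volume_pi_ball x hr.1
    rw [Fintype.card_fin] at hv
    rw [← hv, ← setLIntegral_const, ← lintegral_add_left (hf.indicator hm)]
    refine lintegral_mono fun y => ?_
    by_cases hy : c < f y
    · simp [Set.indicator, hy]
    · simpa [Set.indicator, hy] using not_lt.1 hy
  calc _ ≤ (ENNReal.ofReal ((2 * r) ^ d))⁻¹ * (ENNReal.ofReal ((2 * r) ^ d) *
        maxFn ({x | c < f x}.indicator f) x + c * ENNReal.ofReal ((2 * r) ^ d)) := by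
        exact mul_le_mul_right (h1.trans (add_le_add_left (lintegral_ball_le_maxFn _ _ hr) _)) _
    _ = _ := by
        rw [mul_comm c, ← mul_add, ← mul_assoc, ENNReal.inv_mul_cancel, one_mul]
        · simpa using h0
        · simp

lemma setLIntegral_Ioo_rpow {p a : ℝ} (hp : 1 < p) (ha : 0 ≤ a) :
    ∫⁻ t in Set.Ioo 0 a, ENNReal.ofReal (t ^ (p - 2)) = ENNReal.ofReal (a ^ (p - 1) / (p - 1)) := by
  have hint := intervalIntegral.intervalIntegrable_rpow' (a := 0) (b := a)
    (show -1 < p - 2 by linarith)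
  rw [intervalIntegrable_iff_integrableOn_Ioo_of_le ha] at hint
  rw [← ofReal_integral_eq_lintegral_ofReal hint, ← integral_Ioc_eq_integral_Ioo,
    ← intervalIntegral.integral_of_le ha, integral_rpow (Or.inl (by linarith)),
    Real.zero_rpow (by linarith)]
  · congr 1
    rw [show p - 2 + 1 = p - 1 by ring, sub_zero]
  · filter_upwards [ae_restrict_mem measurableSet_Ioo] with t ht
    exact Real.rpow_nonneg ht.1.le _

/-- The Hardy-Littlewood maximal theorem for bounded functions. -/
lemma lintegral_maxFn_rpow_le {d : ℕ} {p : ℝ} (hp : 1 < p) {f : (Fin d → ℝ) → ℝ≥0∞}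
    (hf : Measurable f) {L : ℝ≥0∞} (hL : L ≠ ∞) (hfL : ∀ x, f x ≤ L) :
    ∫⁻ x, maxFn f x ^ p ≤
      4 ^ d * ENNReal.ofReal (2 ^ p * p / (p - 1)) * ∫⁻ x, f x ^ p := by
  have hfin : ∀ x, maxFn f x ≠ ∞ := fun x => ne_top_of_le_ne_top hL (maxFn_le_of_le hfL x)
  have hffin : ∀ x, f x ≠ ∞ := fun x => ne_top_of_le_ne_top hL (hfL x)
  have h1 : ∫⁻ x, maxFn f x ^ p = ∫⁻ x, ENNReal.ofReal ((maxFn f x).toReal ^ p) := by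
    refine lintegral_congr fun x => ?_
    rw [← ENNReal.ofReal_rpow_of_nonneg ENNReal.toReal_nonneg (by linarith),
      ENNReal.ofReal_toReal (hfin x)]
  have h2 : ∀ t ∈ Set.Ioi (0:ℝ), volume {x | t < (maxFn f x).toReal} * ENNReal.ofReal (t ^ (p - 1))
      ≤ ∫⁻ x, 2 * 4 ^ d * (f x * (Set.Ioo 0 (2 * (f x).toReal)).indicator
          (fun t => ENNReal.ofReal (t ^ (p - 2))) t) := by
    intro t ht
    have ht : 0 < t := ht
    have hsub : {x | t < (maxFn f x).toReal} ⊆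
        {x | ENNReal.ofReal (t / 2) < maxFn ({x | ENNReal.ofReal (t / 2) < f x}.indicator f) x} := by
      intro x hx
      have hx : t < (maxFn f x).toReal := hx
      have h3 : ENNReal.ofReal t < maxFn f x := (ENNReal.ofReal_lt_iff_lt_toReal ht.le (hfin x)).2 hx
      have h4 := h3.trans_le (maxFn_le_maxFn_indicator_add hf (ENNReal.ofReal (t / 2)) x)
      rw [show ENNReal.ofReal t = ENNReal.ofReal (t / 2) + ENNReal.ofReal (t / 2) by
        rw [← ENNReal.ofReal_add (by positivity) (by positivity)]; congr 1; ring] at h4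
      exact lt_of_add_lt_add_right h4
    have h5 : ENNReal.ofReal (t / 2) * volume {x | t < (maxFn f x).toReal} ≤
        4 ^ d * ∫⁻ x, {x | ENNReal.ofReal (t / 2) < f x}.indicator f x :=
      (mul_le_mul_right (measure_mono hsub) _).trans (mul_volume_lt_maxFn_le _ _)
    have h6 : ENNReal.ofReal (t ^ (p - 1)) =
        ENNReal.ofReal (t / 2) * (2 * ENNReal.ofReal (t ^ (p - 2))) := by
      rw [show (2 : ℝ≥0∞) = ENNReal.ofReal 2 by simp, ← ENNReal.ofReal_mul (by norm_num),
        ← ENNReal.ofReal_mul (by positivity)]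
      congr 1
      rw [show p - 1 = 1 + (p - 2) by ring, Real.rpow_add ht, Real.rpow_one]
      ring
    calc _ = (ENNReal.ofReal (t / 2) * volume {x | t < (maxFn f x).toReal}) *
          (2 * ENNReal.ofReal (t ^ (p - 2))) := by rw [h6]; ring
      _ ≤ (4 ^ d * ∫⁻ x, {x | ENNReal.ofReal (t / 2) < f x}.indicator f x) *
          (2 * ENNReal.ofReal (t ^ (p - 2))) := by gcongr
      _ = ∫⁻ x, 2 * 4 ^ d * ({x | ENNReal.ofReal (t / 2) < f x}.indicator f x *
            ENNReal.ofReal (t ^ (p - 2))) := by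
          rw [lintegral_const_mul' _ _ (by finiteness), lintegral_mul_const' _ _ (by finiteness)]
          ring
      _ ≤ _ := by
          refine lintegral_mono fun x => ?_
          gcongr 2 * 4 ^ d * ?_
          by_cases hx : ENNReal.ofReal (t / 2) < f x
          · have : t / 2 < (f x).toReal := (ENNReal.ofReal_lt_iff_lt_toReal (by positivity)
              (hffin x)).1 hx
            have h7 : t ∈ Set.Ioo 0 (2 * (f x).toReal) := ⟨ht, by linarith⟩
            rw [Set.indicator_of_mem h7, Set.indicator_of_mem (by exact hx)]
          · rw [Set.indicator_of_notMem (by exact hx)]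
            simp
  have hmeas : Measurable (Function.uncurry fun (t : ℝ) (x : Fin d → ℝ) =>
      2 * 4 ^ d * (f x * (Set.Ioo 0 (2 * (f x).toReal)).indicator
          (fun t => ENNReal.ofReal (t ^ (p - 2))) t)) := by
    have hS : MeasurableSet {q : ℝ × (Fin d → ℝ) | q.1 ∈ Set.Ioo 0 (2 * (f q.2).toReal)} := by
      refine MeasurableSet.inter (measurableSet_lt measurable_const measurable_fst)
        (measurableSet_lt measurable_fst ?_)
      exact ((hf.comp measurable_snd).ennreal_toReal).const_mul 2
    refine Measurable.const_mul (Measurable.mul (hf.comp measurable_snd) ?_) _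
    have : Measurable fun q : ℝ × (Fin d → ℝ) => ENNReal.ofReal (q.1 ^ (p - 2)) := by fun_prop
    exact this.indicator hS
  rw [h1, lintegral_rpow_eq_lintegral_meas_lt_mul volume (ae_of_all _ fun x => ENNReal.toReal_nonneg)
    (measurable_maxFn f).ennreal_toReal.aemeasurable (by linarith)]
  calc _ ≤ ENNReal.ofReal p * ∫⁻ t in Set.Ioi (0:ℝ), ∫⁻ x, 2 * 4 ^ d * (f x *
        (Set.Ioo 0 (2 * (f x).toReal)).indicator (fun t => ENNReal.ofReal (t ^ (p - 2))) t) := by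
        gcongr ENNReal.ofReal p * ?_
        exact setLIntegral_mono' measurableSet_Ioi h2
    _ = ENNReal.ofReal p * ∫⁻ x, ∫⁻ t in Set.Ioi (0:ℝ), 2 * 4 ^ d * (f x *
        (Set.Ioo 0 (2 * (f x).toReal)).indicator (fun t => ENNReal.ofReal (t ^ (p - 2))) t) := by
        rw [lintegral_lintegral_swap hmeas.aemeasurable]
    _ = ENNReal.ofReal p * ∫⁻ x, 4 ^ d * ENNReal.ofReal (2 ^ p / (p - 1)) * f x ^ p := by
        congr 1
        refine lintegral_congr fun x => ?_
        rw [lintegral_const_mul' _ _ (by finiteness), lintegral_const_mul' _ _ (hffin x),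
          lintegral_indicator measurableSet_Ioo, Measure.restrict_restrict measurableSet_Ioo,
          Set.inter_eq_left.2 Set.Ioo_subset_Ioi_self, setLIntegral_Ioo_rpow hp (by positivity)]
        set a := (f x).toReal with ha
        have ha0 : 0 ≤ a := ENNReal.toReal_nonneg
        rw [show f x = ENNReal.ofReal a from (ENNReal.ofReal_toReal (hffin x)).symm,
          ENNReal.ofReal_rpow_of_nonneg ha0 (by linarith), ← ENNReal.ofReal_mul ha0,
          show (2 : ℝ≥0∞) = ENNReal.ofReal 2 by simp, mul_assoc _ (ENNReal.ofReal _),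
          ← ENNReal.ofReal_mul (div_nonneg (by positivity) (by linarith)), mul_comm (ENNReal.ofReal 2),
          mul_assoc, ← ENNReal.ofReal_mul (by norm_num)]
        congr 2
        rcases ha0.eq_or_lt with h | h
        · rw [← h, Real.zero_rpow (by linarith)]; simp
        · rw [Real.mul_rpow (by norm_num) ha0, Real.rpow_sub_one h.ne', Real.rpow_sub_one (by norm_num)]
          field_simp
    _ = _ := by
        rw [lintegral_const_mul' _ _ (by finiteness), ← mul_assoc, mul_left_comm,
          ← ENNReal.ofReal_mul (by linarith)]
        congr 3
        ring

lemma measurableSet_box (d : ℕ) : MeasurableSet (box d) :=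
  MeasurableSet.univ_pi fun _ => measurableSet_Ico

lemma volume_box (d : ℕ) : volume (box d) = 1 := by
  simp [box, Real.volume_pi_Ico]

lemma mem_box_iff_floor {d : ℕ} {x : Fin d → ℝ} : x ∈ box d ↔ ∀ i, ⌊x i⌋ = 0 := by
  simp [box, Int.floor_eq_zero_iff]

lemma exists_add_mem_box {d : ℕ} (x : Fin d → ℝ) :
    ∃ k : Fin d → ℤ, (x + fun i => (k i : ℝ)) ∈ box d := by
  refine ⟨fun i => -⌊x i⌋, mem_box_iff_floor.2 fun i => ?_⟩
  rw [Pi.add_apply, Int.floor_add_intCast]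
  ring

lemma setLIntegral_le_setLIntegral_box {d : ℕ} {F : (Fin d → ℝ) → ℝ≥0∞} (hF : IsPeriodic F)
    {S : Set (Fin d → ℝ)} (hS : MeasurableSet S)
    (hinj : ∀ x ∈ S, ∀ k : Fin d → ℤ, (x + fun i => (k i : ℝ)) ∈ S → k = 0) :
    ∫⁻ x in S, F x ≤ ∫⁻ x in box d, F x := by
  set A : (Fin d → ℤ) → Set (Fin d → ℝ) := fun k => S ∩ {x | ∀ i, ⌊x i⌋ = k i} with hA
  set B : (Fin d → ℤ) → Set (Fin d → ℝ) := fun k => (fun x => x + fun i => (k i : ℝ)) ⁻¹' A k with hB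
  have hAm : ∀ k, MeasurableSet (A k) := by
    intro k
    refine hS.inter ?_
    rw [Set.ofPred_forall]
    exact MeasurableSet.iInter fun i =>
      (Int.measurable_floor.comp (measurable_pi_apply i)) (measurableSet_singleton (k i))
  have hBm : ∀ k, MeasurableSet (B k) := fun k => (hAm k).preimage (measurable_add_const _)
  have hSA : S = ⋃ k, A k := by
    ext x
    simp [hA]
    intro _
    exact ⟨fun i => ⌊x i⌋, fun i => rfl⟩
  have hAd : Pairwise (Function.onFun Disjoint A) := by
    intro k l hkl
    refine Set.disjoint_left.2 fun x hx hx' => hkl (funext fun i => ?_)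
    rw [← hx.2 i, ← hx'.2 i]
  have hBd : Pairwise (Function.onFun Disjoint B) := by
    intro k l hkl
    refine Set.disjoint_left.2 fun x hx hx' => hkl ?_
    have h1 := hinj _ hx.1 (l - k) (by
      have := hx'.1
      convert this using 1
      ext i
      simp)
    exact (sub_eq_zero.1 h1).symm
  have hAB : ∀ k, ∫⁻ x in A k, F x = ∫⁻ x in B k, F x := by
    intro k
    rw [← lintegral_indicator (hAm k), ← lintegral_indicator (hBm k),
      ← lintegral_add_right_eq_self _ (fun i => (k i : ℝ))]
    refine lintegral_congr fun x => ?_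
    by_cases hx : x ∈ B k
    · have hx' : (x + fun i => (k i : ℝ)) ∈ A k := hx
      rw [Set.indicator_of_mem hx, Set.indicator_of_mem hx', hF x k]
    · have hx' : (x + fun i => (k i : ℝ)) ∉ A k := hx
      rw [Set.indicator_of_notMem hx, Set.indicator_of_notMem hx']
  have hBbox : ⋃ k, B k ⊆ box d := by
    refine Set.iUnion_subset fun k x hx => mem_box_iff_floor.2 fun i => ?_
    have := hx.2 i
    simp only [Pi.add_apply, Int.floor_add_intCast] at this
    linarith
  rw [hSA, lintegral_iUnion hAm hAd]
  simp_rw [hAB]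
  rw [← lintegral_iUnion hBm hBd]
  exact lintegral_mono_set hBbox

lemma setLIntegral_box_comp_add_le {d : ℕ} {F : (Fin d → ℝ) → ℝ≥0∞} (hF : IsPeriodic F)
    (h : Fin d → ℝ) : ∫⁻ x in box d, F (x + h) ≤ ∫⁻ x in box d, F x := by
  have hm : MeasurableSet ((fun x => x + h) '' box d) :=
    (measurableEmbedding_addRight h).measurableSet_image.2 (measurableSet_box d)
  have h1 : ∫⁻ x in box d, F (x + h) = ∫⁻ x in (fun x => x + h) '' box d, F x := by
    rw [← lintegral_indicator (measurableSet_box d), ← lintegral_indicator hm,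
      ← lintegral_add_right_eq_self (Set.indicator _ F) h]
    refine lintegral_congr fun x => ?_
    by_cases hx : x ∈ box d
    · rw [Set.indicator_of_mem hx, Set.indicator_of_mem (Set.mem_image_of_mem _ hx)]
    · rw [Set.indicator_of_notMem hx, Set.indicator_of_notMem]
      rintro ⟨y, hy, hxy⟩
      exact hx (add_right_cancel hxy ▸ hy)
  rw [h1]
  refine setLIntegral_le_setLIntegral_box hF hm ?_
  rintro _ ⟨x, hx, rfl⟩ k ⟨y, hy, hxy⟩
  ext i
  have h2 := mem_box_iff_floor.1 hx i
  have h3 := mem_box_iff_floor.1 hy i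
  have h4 : y i = x i + k i := by
    have := congrFun hxy i
    simp at this
    linarith
  rw [h4, Int.floor_add_intCast, h2] at h3
  simpa using h3

lemma setLIntegral_box_comp_add {d : ℕ} {F : (Fin d → ℝ) → ℝ≥0∞} (hF : IsPeriodic F)
    (h : Fin d → ℝ) : ∫⁻ x in box d, F (x + h) = ∫⁻ x in box d, F x := by
  refine le_antisymm (setLIntegral_box_comp_add_le hF h) ?_
  have hF' : IsPeriodic fun x => F (x + h) := fun x k => by
    show F (x + _ + h) = _
    rw [add_right_comm]; exact hF _ k
  simpa using setLIntegral_box_comp_add_le hF' (-h)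

/-- The union of the integer translates of the unit box adjacent to it. -/
def bigBox (d : ℕ) : Set (Fin d → ℝ) := Set.univ.pi fun _ => Set.Ico (-1:ℝ) 2

lemma measurableSet_bigBox (d : ℕ) : MeasurableSet (bigBox d) :=
  MeasurableSet.univ_pi fun _ => measurableSet_Ico

lemma ball_subset_bigBox {d : ℕ} {x : Fin d → ℝ} (hx : x ∈ box d) :
    Metric.ball x 1 ⊆ bigBox d := by
  intro y hy i _
  have h1 : |y i - x i| < 1 := by
    rw [← Real.dist_eq]
    exact (dist_le_pi_dist y x i).trans_lt hy
  have h2 := hx i trivial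
  rw [abs_lt] at h1
  exact ⟨by linarith [h2.1], by linarith [h2.2]⟩

lemma setLIntegral_bigBox_le {d : ℕ} {F : (Fin d → ℝ) → ℝ≥0∞} (hF : IsPeriodic F) :
    ∫⁻ x in bigBox d, F x ≤ 3 ^ d * ∫⁻ x in box d, F x := by
  set K : Finset (Fin d → ℤ) := Fintype.piFinset fun _ => Finset.Icc (-1) 1 with hK
  have hsub : bigBox d ⊆ ⋃ k : K, (fun x => x + fun i => -((k : Fin d → ℤ) i : ℝ)) ⁻¹' box d := by
    intro x hx
    have hk : (fun i => ⌊x i⌋) ∈ K := by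
      refine Fintype.mem_piFinset.2 fun i => Finset.mem_Icc.2 ⟨?_, ?_⟩
      · exact Int.le_floor.2 (by simpa using (hx i trivial).1)
      · exact Int.lt_add_one_iff.1 (Int.floor_lt.2 (by simpa using (hx i trivial).2))
    refine Set.mem_iUnion.2 ⟨⟨_, hk⟩, ?_⟩
    refine mem_box_iff_floor.2 fun i => ?_
    simp only [Pi.add_apply]
    rw [← Int.cast_neg, Int.floor_add_intCast]
    ring
  calc ∫⁻ x in bigBox d, F x
      ≤ ∑' k : K, ∫⁻ x in (fun x => x + fun i => -((k : Fin d → ℤ) i : ℝ)) ⁻¹' box d, F x :=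
        (lintegral_mono_set hsub).trans (lintegral_iUnion_le _ _)
    _ ≤ ∑' k : K, ∫⁻ x in box d, F x := by
        refine ENNReal.tsum_le_tsum fun k => ?_
        refine setLIntegral_le_setLIntegral_box hF
          ((measurableSet_box d).preimage (measurable_add_const _)) ?_
        intro x hx l hl
        ext i
        have h2 := mem_box_iff_floor.1 hx i
        have h3 := mem_box_iff_floor.1 hl i
        simp only [Pi.add_apply, ← Int.cast_neg, Int.floor_add_intCast] at h2 h3
        simp only [Pi.zero_apply]
        linarith
    _ = 3 ^ d * ∫⁻ x in box d, F x := by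
        rw [tsum_fintype, Finset.sum_const, Finset.card_univ, Fintype.card_coe, hK,
          Fintype.card_piFinset, nsmul_eq_mul]
        simp

lemma setLIntegral_box_comp_le {d : ℕ} {F : (Fin d → ℝ) → ℝ≥0∞} (hF : IsPeriodic F)
    {S : (Fin d → ℝ) → (Fin d → ℝ)} {S' : (Fin d → ℝ) → (Fin d → ℝ) →L[ℝ] (Fin d → ℝ)}
    (hS' : ∀ x, HasFDerivAt S (S' x) x) (hinj : Function.Injective S)
    (hper : ∀ x (k : Fin d → ℤ), S (x + fun i => (k i : ℝ)) = S x + fun i => (k i : ℝ))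
    {J : ℝ} (hdet : ∀ x, 1 ≤ J * |(S' x).det|) (hJ : 0 ≤ J) :
    ∫⁻ x in box d, F (S x) ≤ ENNReal.ofReal J * ∫⁻ x in box d, F x := by
  have hcont : Continuous S := continuous_iff_continuousAt.2 fun x => (hS' x).continuousAt
  have hm : MeasurableSet (S '' box d) :=
    (measurableSet_box d).image_of_continuousOn_injOn hcont.continuousOn hinj.injOn
  calc ∫⁻ x in box d, F (S x)
      ≤ ∫⁻ x in box d, ENNReal.ofReal J * (ENNReal.ofReal |(S' x).det| * F (S x)) := by
        refine lintegral_mono fun x => ?_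
        rw [← mul_assoc, ← ENNReal.ofReal_mul hJ]
        exact le_mul_of_one_le_left zero_le (by simpa using hdet x)
    _ = ENNReal.ofReal J * ∫⁻ x in S '' box d, F x := by
        rw [lintegral_const_mul' _ _ ENNReal.ofReal_ne_top,
          lintegral_image_eq_lintegral_abs_det_fderiv_mul _ (measurableSet_box d)
            (fun x _ => (hS' x).hasFDerivWithinAt) hinj.injOn]
    _ ≤ ENNReal.ofReal J * ∫⁻ x in box d, F x := by
        gcongr ENNReal.ofReal J * ?_
        refine setLIntegral_le_setLIntegral_box hF hm ?_
        rintro _ ⟨x, hx, rfl⟩ k ⟨y, hy, hxy⟩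
        rw [← hper] at hxy
        have hxy := hinj hxy
        ext i
        have h2 := mem_box_iff_floor.1 hx i
        have h3 := mem_box_iff_floor.1 hy i
        rw [hxy, Pi.add_apply, Int.floor_add_intCast, h2] at h3
        simpa using h3

lemma setLIntegral_ball_comp_add {d : ℕ} (f : (Fin d → ℝ) → ℝ≥0∞) (x z : Fin d → ℝ) (r : ℝ) :
    ∫⁻ w in Metric.ball z r, f (x + w) = ∫⁻ y in Metric.ball (x + z) r, f y := by
  rw [← lintegral_indicator Metric.isOpen_ball.measurableSet,
    ← lintegral_indicator Metric.isOpen_ball.measurableSet,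
    ← lintegral_add_left_eq_self (Set.indicator (Metric.ball (x + z) r) f) x]
  refine lintegral_congr fun w => ?_
  by_cases hw : w ∈ Metric.ball z r
  · rw [Set.indicator_of_mem hw, Set.indicator_of_mem]
    simpa using hw
  · rw [Set.indicator_of_notMem hw, Set.indicator_of_notMem]
    simpa using hw

lemma setLIntegral_ball_comp_smul {d : ℕ} {f : (Fin d → ℝ) → ℝ≥0∞} (hf : Measurable f)
    (r : ℝ) {t : ℝ} (ht : 0 < t) :
    ∫⁻ w in Metric.ball 0 r, f (t • w) =
      (ENNReal.ofReal (t ^ d))⁻¹ * ∫⁻ y in Metric.ball 0 (t * r), f y := by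
  have h := Measure.map_addHaar_smul (volume : Measure (Fin d → ℝ)) ht.ne'
  have hm : Measurable ((Metric.ball (0 : Fin d → ℝ) (t * r)).indicator f) :=
    hf.indicator Metric.isOpen_ball.measurableSet
  have h1 := lintegral_map (μ := volume) hm (measurable_const_smul t)
  rw [h, lintegral_smul_measure, lintegral_indicator Metric.isOpen_ball.measurableSet,
    Module.finrank_fin_fun, abs_of_pos (by positivity), ENNReal.ofReal_inv_of_pos (by positivity),
    smul_eq_mul] at h1
  rw [h1, ← lintegral_indicator Metric.isOpen_ball.measurableSet]
  refine lintegral_congr fun w => ?_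
  have : t • w ∈ Metric.ball (0 : Fin d → ℝ) (t * r) ↔ w ∈ Metric.ball (0 : Fin d → ℝ) r := by
    simp [norm_smul, abs_of_pos ht, mul_lt_mul_iff_right₀ ht]
  by_cases hw : w ∈ Metric.ball (0 : Fin d → ℝ) r
  · rw [Set.indicator_of_mem hw, Set.indicator_of_mem (this.2 hw)]
  · rw [Set.indicator_of_notMem hw, Set.indicator_of_notMem (fun h => hw (this.1 h))]

lemma enorm_sub_le_lintegral_fderiv {d : ℕ} {b : (Fin d → ℝ) → (Fin d → ℝ)}
    (hb : ContDiff ℝ 1 b) (x w : Fin d → ℝ) :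
    ‖b (x + w) - b x‖ₑ ≤ ∫⁻ t in Set.Ioc (0:ℝ) 1, ‖fderiv ℝ b (x + t • w)‖ₑ * ‖w‖ₑ := by
  have hd : ∀ t ∈ Set.uIcc (0:ℝ) 1,
      HasDerivAt (fun t : ℝ => b (x + t • w)) (fderiv ℝ b (x + t • w) w) t := by
    intro t _
    have h1 : HasDerivAt (fun t : ℝ => x + t • w) w t := by
      simpa using ((hasDerivAt_id t).smul_const w).const_add x
    exact (hb.differentiable one_ne_zero _).hasFDerivAt.comp_hasDerivAt t h1
  have hc : Continuous fun t : ℝ => fderiv ℝ b (x + t • w) w :=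
    ((hb.continuous_fderiv one_ne_zero).comp (by fun_prop)).clm_apply continuous_const
  have h2 := intervalIntegral.integral_eq_sub_of_hasDerivAt hd (hc.intervalIntegrable 0 1)
  simp only [one_smul, zero_smul, add_zero] at h2
  rw [← h2, intervalIntegral.integral_of_le zero_le_one]
  refine (enorm_integral_le_lintegral_enorm _).trans (lintegral_mono fun t => ?_)
  exact ContinuousLinearMap.le_opENorm _ _

lemma lintegral_ball_enorm_sub_le {d : ℕ} {b : (Fin d → ℝ) → (Fin d → ℝ)}
    (hb : ContDiff ℝ 1 b) (x : Fin d → ℝ) {r : ℝ} (hr : r ∈ Set.Ioc (0:ℝ) 1) :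
    ∫⁻ y in Metric.ball x r, ‖b y - b x‖ₑ ≤
      ENNReal.ofReal r * ENNReal.ofReal ((2 * r) ^ d) * maxFn (fun x => ‖fderiv ℝ b x‖ₑ) x := by
  set f : (Fin d → ℝ) → ℝ≥0∞ := fun x => ‖fderiv ℝ b x‖ₑ with hf
  have hcf : Continuous f := (hb.continuous_fderiv one_ne_zero).enorm
  have h0 : ∫⁻ y in Metric.ball x r, ‖b y - b x‖ₑ =
      ∫⁻ w in Metric.ball 0 r, ‖b (x + w) - b x‖ₑ := by
    rw [setLIntegral_ball_comp_add (fun y => ‖b y - b x‖ₑ), add_zero]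
  rw [h0]
  calc _ ≤ ∫⁻ w in Metric.ball 0 r, ∫⁻ t in Set.Ioc (0:ℝ) 1, f (x + t • w) * ENNReal.ofReal r := by
        refine setLIntegral_mono' Metric.isOpen_ball.measurableSet fun w hw => ?_
        refine (enorm_sub_le_lintegral_fderiv hb x w).trans (lintegral_mono fun t => ?_)
        gcongr
        rw [← ofReal_norm]
        exact ENNReal.ofReal_le_ofReal (by simpa using (Metric.mem_ball.1 hw).le)
    _ = ∫⁻ t in Set.Ioc (0:ℝ) 1, ∫⁻ w in Metric.ball 0 r, f (x + t • w) * ENNReal.ofReal r := by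
        refine lintegral_lintegral_swap (Measurable.aemeasurable ?_)
        exact ((hcf.comp (by fun_prop :
          Continuous fun q : (Fin d → ℝ) × ℝ => x + q.2 • q.1)).measurable).mul_const _
    _ ≤ ∫⁻ t in Set.Ioc (0:ℝ) 1, ENNReal.ofReal r * ENNReal.ofReal ((2 * r) ^ d) * maxFn f x := by
        refine setLIntegral_mono' measurableSet_Ioc fun t ht => ?_
        have htr : t * r ∈ Set.Ioc (0:ℝ) 1 :=
          ⟨mul_pos ht.1 hr.1, mul_le_one₀ ht.2 hr.1.le hr.2⟩
        have htd : 0 < t ^ d := pow_pos ht.1 d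
        rw [lintegral_mul_const' _ _ ENNReal.ofReal_ne_top,
          setLIntegral_ball_comp_smul (f := fun w => f (x + w))
            (hcf.measurable.comp (measurable_const_add x)) r ht.1,
          setLIntegral_ball_comp_add, add_zero]
        calc _ ≤ (ENNReal.ofReal (t ^ d))⁻¹ * (ENNReal.ofReal ((2 * (t * r)) ^ d) * maxFn f x) *
              ENNReal.ofReal r := by
              gcongr
              exact lintegral_ball_le_maxFn f x htr
          _ = ((ENNReal.ofReal (t ^ d))⁻¹ * ENNReal.ofReal (t ^ d)) * (ENNReal.ofReal r *
              ENNReal.ofReal ((2 * r) ^ d) * maxFn f x) := by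
              rw [show (2 * (t * r)) ^ d = t ^ d * (2 * r) ^ d by rw [← mul_pow]; ring,
                ENNReal.ofReal_mul htd.le]
              ring
          _ = _ := by
              rw [ENNReal.inv_mul_cancel (by simpa using htd) ENNReal.ofReal_ne_top, one_mul]
    _ = _ := by simp

/-- A `C¹` vector field satisfies a Lipschitz estimate with the maximal function of its gradient
as a pointwise weight. -/
lemma enorm_sub_le_maxFn {d : ℕ} {b : (Fin d → ℝ) → (Fin d → ℝ)}
    (hb : ContDiff ℝ 1 b) {x y : Fin d → ℝ} (hxy : ‖x - y‖ ≤ 1) :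
    ‖b x - b y‖ₑ ≤ 2 ^ d * ‖x - y‖ₑ * (maxFn (fun x => ‖fderiv ℝ b x‖ₑ) x +
      maxFn (fun x => ‖fderiv ℝ b x‖ₑ) y) := by
  rcases eq_or_ne x y with rfl | hne
  · simp
  set M := maxFn (fun x => ‖fderiv ℝ b x‖ₑ) with hM
  set r := ‖x - y‖ with hr
  have hr0 : 0 < r := norm_pos_iff.2 (sub_ne_zero.2 hne)
  set m := midpoint ℝ x y with hm
  have hx : Metric.ball m (r / 2) ⊆ Metric.ball x r := by
    apply Metric.ball_subset_ball'
    rw [hm, dist_midpoint_left, dist_eq_norm, ← hr, Real.norm_of_nonneg (by norm_num)]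
    linarith
  have hy : Metric.ball m (r / 2) ⊆ Metric.ball y r := by
    apply Metric.ball_subset_ball'
    rw [hm, dist_midpoint_right, dist_eq_norm, ← hr, Real.norm_of_nonneg (by norm_num)]
    linarith
  have hrd : 0 < r ^ d := pow_pos hr0 d
  have hv : volume (Metric.ball m (r / 2)) = ENNReal.ofReal (r ^ d) := by
    rw [Real.volume_pi_ball _ (by linarith), Fintype.card_fin]
    congr 2
    ring
  have hcb := hb.continuous
  have key : ‖b x - b y‖ₑ * ENNReal.ofReal (r ^ d) ≤
      2 ^ d * ‖x - y‖ₑ * (M x + M y) * ENNReal.ofReal (r ^ d) := by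
    calc ‖b x - b y‖ₑ * ENNReal.ofReal (r ^ d) = ∫⁻ w in Metric.ball m (r / 2), ‖b x - b y‖ₑ := by
          rw [setLIntegral_const, hv]
      _ ≤ ∫⁻ w in Metric.ball m (r / 2), (‖b w - b x‖ₑ + ‖b w - b y‖ₑ) := by
          refine lintegral_mono fun w => ?_
          have : b x - b y = -(b w - b x) + (b w - b y) := by abel
          rw [this]
          exact (enorm_add_le _ _).trans (by rw [enorm_neg])
      _ = (∫⁻ w in Metric.ball m (r / 2), ‖b w - b x‖ₑ) +
          ∫⁻ w in Metric.ball m (r / 2), ‖b w - b y‖ₑ :=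
          lintegral_add_left (by fun_prop) _
      _ ≤ (∫⁻ w in Metric.ball x r, ‖b w - b x‖ₑ) + ∫⁻ w in Metric.ball y r, ‖b w - b y‖ₑ :=
          add_le_add (lintegral_mono_set hx) (lintegral_mono_set hy)
      _ ≤ ENNReal.ofReal r * ENNReal.ofReal ((2 * r) ^ d) * M x +
          ENNReal.ofReal r * ENNReal.ofReal ((2 * r) ^ d) * M y :=
          add_le_add (lintegral_ball_enorm_sub_le hb x ⟨hr0, hxy⟩)
            (lintegral_ball_enorm_sub_le hb y ⟨hr0, hxy⟩)
      _ = _ := by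
          rw [mul_pow, ENNReal.ofReal_mul (by positivity), ENNReal.ofReal_pow (by norm_num),
            hr, ofReal_norm]
          norm_num
          ring
  exact (ENNReal.mul_le_mul_iff_left (by simpa using hrd) ENNReal.ofReal_ne_top).1 key

lemma IsPeriodic.maxFn {d : ℕ} {f : (Fin d → ℝ) → ℝ≥0∞} (hf : IsPeriodic f) :
    IsPeriodic (maxFn f) := by
  intro x k
  unfold _root_.maxFn
  refine iSup_congr fun r => iSup_congr fun hr => ?_
  rw [add_comm x, ← setLIntegral_ball_comp_add]
  congr 1
  refine lintegral_congr fun y => ?_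
  rw [add_comm]
  exact hf y k

lemma IsPeriodic.fderiv {d : ℕ} {b : (Fin d → ℝ) → (Fin d → ℝ)} (hb : IsPeriodic b) :
    IsPeriodic (fderiv ℝ b) := by
  intro x k
  rw [← fderiv_comp_add_right]
  congr 1
  funext y
  exact hb y k

lemma setLIntegral_box_maxFn_rpow_le {d : ℕ} {p : ℝ} (hp : 1 < p) {f : (Fin d → ℝ) → ℝ≥0∞}
    (hf : Measurable f) (hper : IsPeriodic f) {L : ℝ≥0∞} (hL : L ≠ ∞) (hfL : ∀ x, f x ≤ L) :
    ∫⁻ x in box d, maxFn f x ^ p ≤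
      12 ^ d * ENNReal.ofReal (2 ^ p * p / (p - 1)) * ∫⁻ x in box d, f x ^ p := by
  have hp0 : 0 < p := by linarith
  set g := (bigBox d).indicator f with hg
  have hgm : Measurable g := hf.indicator (measurableSet_bigBox d)
  calc ∫⁻ x in box d, maxFn f x ^ p = ∫⁻ x in box d, maxFn g x ^ p := by
        refine setLIntegral_congr_fun (measurableSet_box d) fun x hx => ?_
        rw [maxFn_congr (g := g) fun y hy => ?_]
        rw [hg, Set.indicator_of_mem (ball_subset_bigBox hx hy)]
    _ ≤ ∫⁻ x, maxFn g x ^ p := setLIntegral_le_lintegral _ _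
    _ ≤ 4 ^ d * ENNReal.ofReal (2 ^ p * p / (p - 1)) * ∫⁻ x, g x ^ p :=
        lintegral_maxFn_rpow_le hp hgm hL fun x =>
          (Set.indicator_le_self _ _ x).trans (hfL x)
    _ = 4 ^ d * ENNReal.ofReal (2 ^ p * p / (p - 1)) * ∫⁻ x in bigBox d, f x ^ p := by
        rw [← lintegral_indicator (measurableSet_bigBox d)]
        congr 1
        refine lintegral_congr fun x => ?_
        by_cases hx : x ∈ bigBox d
        · simp [hg, hx]
        · simp [hg, hx, hp0]
    _ ≤ 4 ^ d * ENNReal.ofReal (2 ^ p * p / (p - 1)) * (3 ^ d * ∫⁻ x in box d, f x ^ p) := by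
        gcongr
        exact setLIntegral_bigBox_le fun x k => by simp only [hper x k]
    _ = _ := by
        rw [show (12 : ℝ≥0∞) = 4 * 3 by norm_num, mul_pow]
        ring

/-- Periodic `C¹` vector fields satisfy a Lipschitz estimate with a pointwise weight whose
`L^p` norm is controlled by that of the gradient. -/
lemma exists_lipschitz_weight (d : ℕ) {p : ℝ} (hp : 1 < p) :
    ∃ A : ℝ, 0 < A ∧ ∀ b : (Fin d → ℝ) → (Fin d → ℝ), ContDiff ℝ 1 b → IsPeriodic b →
      ∀ L : ℝ, (∀ x, ‖fderiv ℝ b x‖ ≤ L) →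
      ∃ G : (Fin d → ℝ) → ℝ, Measurable G ∧ (∀ x, 0 ≤ G x) ∧ IsPeriodic G ∧
        (∀ x y, ‖b x - b y‖ ≤ ‖x - y‖ * (G x + G y)) ∧
        eLpNorm G (ENNReal.ofReal p) (volume.restrict (box d)) ≤ ENNReal.ofReal A *
          eLpNorm (fun x => ‖fderiv ℝ b x‖) (ENNReal.ofReal p) (volume.restrict (box d)) := by
  have hp0 : 0 < p := by linarith
  have hK : 0 < 2 ^ p * p / (p - 1) := div_pos (by positivity) (by linarith)
  refine ⟨2 ^ d * (12 ^ d * (2 ^ p * p / (p - 1))) ^ (1 / p), by positivity, ?_⟩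
  intro b hb hper L hL
  set f : (Fin d → ℝ) → ℝ≥0∞ := fun x => ‖fderiv ℝ b x‖ₑ with hf
  have hfper : IsPeriodic f := fun x k => by simp only [hf, hper.fderiv x k]
  have hfm : Measurable f := (hb.continuous_fderiv one_ne_zero).enorm.measurable
  have hfL : ∀ x, f x ≤ ENNReal.ofReal L := fun x => by
    rw [hf]
    simp only
    rw [← ofReal_norm]
    exact ENNReal.ofReal_le_ofReal (hL x)
  have hfin : ∀ x, maxFn f x ≠ ∞ := fun x =>
    ne_top_of_le_ne_top ENNReal.ofReal_ne_top (maxFn_le_of_le hfL x)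
  have hloc : ∀ x y, ‖x - y‖ ≤ 1 → ‖b x - b y‖ ≤
      ‖x - y‖ * (2 ^ d * (maxFn f x).toReal + 2 ^ d * (maxFn f y).toReal) := by
    intro x y hxy
    have h := enorm_sub_le_maxFn hb hxy
    have h2 := ENNReal.toReal_mono (by finiteness [hfin x, hfin y]) h
    simp only [toReal_enorm, ENNReal.toReal_mul, ENNReal.toReal_pow, ENNReal.toReal_ofNat] at h2
    rw [ENNReal.toReal_add (hfin x) (hfin y)] at h2
    refine h2.trans (le_of_eq ?_)
    ring
  refine ⟨fun x => 2 ^ d * (maxFn f x).toReal, ((measurable_maxFn f).ennreal_toReal).const_mul _,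
    fun x => by positivity, fun x k => by simp only [hfper.maxFn x k], fun x y => ?_, ?_⟩
  · rcases le_or_gt ‖x - y‖ 1 with h | h
    · exact hloc x y h
    · set y' : Fin d → ℝ := y + fun i => ((⌊x i - y i⌋ : ℤ) : ℝ) with hy'
      have hy1 : ‖x - y'‖ ≤ 1 := by
        refine (pi_norm_le_iff_of_nonneg zero_le_one).2 fun i => ?_
        have : (x - y') i = Int.fract (x i - y i) := by
          simp only [hy', Pi.sub_apply, Pi.add_apply, Int.fract]
          ring
        rw [this, Real.norm_of_nonneg (Int.fract_nonneg _)]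
        exact (Int.fract_lt_one _).le
      have h1 := hloc x y' hy1
      have hby : b y' = b y := hper y fun i => ⌊x i - y i⌋
      have hfy : maxFn f y' = maxFn f y := hfper.maxFn y fun i => ⌊x i - y i⌋
      rw [hby, hfy] at h1
      refine h1.trans ?_
      gcongr
      exact hy1.trans h.le
  · have hpne : ENNReal.ofReal p ≠ 0 := by simpa using hp0
    rw [eLpNorm_eq_lintegral_rpow_enorm_toReal hpne ENNReal.ofReal_ne_top,
      eLpNorm_eq_lintegral_rpow_enorm_toReal hpne ENNReal.ofReal_ne_top,
      ENNReal.toReal_ofReal hp0.le]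
    have hG : ∀ x, ‖2 ^ d * (maxFn f x).toReal‖ₑ = 2 ^ d * maxFn f x := by
      intro x
      rw [Real.enorm_of_nonneg (by positivity), ENNReal.ofReal_mul (by positivity),
        ENNReal.ofReal_toReal (hfin x), ENNReal.ofReal_pow (by norm_num)]
      norm_num
    simp_rw [hG, enorm_norm, ENNReal.mul_rpow_of_nonneg _ _ hp0.le]
    rw [lintegral_const_mul' _ _ (by finiteness), ENNReal.mul_rpow_of_nonneg _ _ (by positivity),
      ← ENNReal.rpow_mul, mul_one_div_cancel hp0.ne', ENNReal.rpow_one,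
      ENNReal.ofReal_mul (by positivity), ← ENNReal.ofReal_rpow_of_pos (by positivity),
      ENNReal.ofReal_mul (by positivity), mul_assoc,
      ← ENNReal.mul_rpow_of_nonneg _ _ (by positivity : 0 ≤ 1 / p)]
    have := setLIntegral_box_maxFn_rpow_le hp hfm hfper ENNReal.ofReal_ne_top hfL
    rw [ENNReal.ofReal_pow (by norm_num), ENNReal.ofReal_pow (by norm_num)]
    norm_num only [ENNReal.ofReal_ofNat]
    gcongr

lemma continuous_eNorm (d : ℕ) : Continuous (eNorm : (Fin d → ℝ) → ℝ) := by
  unfold eNorm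
  fun_prop

lemma eNorm_nonneg {d : ℕ} (h : Fin d → ℝ) : 0 ≤ eNorm h := Real.sqrt_nonneg _

lemma norm_le_eNorm {d : ℕ} (h : Fin d → ℝ) : ‖h‖ ≤ eNorm h := by
  refine (pi_norm_le_iff_of_nonneg (eNorm_nonneg h)).2 fun i => ?_
  refine Real.le_sqrt_of_sq_le ?_
  rw [Real.norm_eq_abs, sq_abs]
  exact Finset.single_le_sum (f := fun i => h i ^ 2) (fun j _ => sq_nonneg _) (Finset.mem_univ i)

lemma eNorm_le_mul_norm {d : ℕ} (h : Fin d → ℝ) : eNorm h ≤ d * ‖h‖ := by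
  refine Real.sqrt_le_iff.2 ⟨by positivity, ?_⟩
  calc ∑ i, h i ^ 2 ≤ ∑ _i : Fin d, ‖h‖ ^ 2 := by
        refine Finset.sum_le_sum fun i _ => ?_
        rw [← sq_abs, ← Real.norm_eq_abs]
        gcongr
        exact norm_le_pi_norm h i
    _ = d * ‖h‖ ^ 2 := by simp
    _ ≤ (d * ‖h‖) ^ 2 := by
        rw [mul_pow]
        gcongr
        rcases Nat.eq_zero_or_pos d with rfl | hd
        · simp
        · exact le_self_pow₀ (by exact_mod_cast hd) two_ne_zero

@[simp] lemma eNorm_zero (d : ℕ) : eNorm (0 : Fin d → ℝ) = 0 := by simp [eNorm]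

lemma eNorm_pos {d : ℕ} {h : Fin d → ℝ} (hh : h ≠ 0) : 0 < eNorm h :=
  (norm_pos_iff.2 hh).trans_le (norm_le_eNorm h)

/-- The weight defining the logarithmic seminorm. -/
def logKernel (d : ℕ) (p : ℝ) (h : Fin d → ℝ) : ℝ :=
  eNorm h ^ (-(d:ℝ)) * Real.log (1 / eNorm h) ^ (p - 1)

lemma measurable_logKernel (d : ℕ) (p : ℝ) : Measurable (logKernel d p) := by
  have := (continuous_eNorm d).measurable
  unfold logKernel
  fun_prop

lemma log_one_div_pos {r : ℝ} (hr : 0 < r) (hr3 : r < 1/3) : 1 < Real.log (1 / r) := by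
  rw [Real.lt_log_iff_exp_lt (by positivity)]
  have : Real.exp 1 < 3 := Real.exp_one_lt_d9.trans (by norm_num)
  refine this.trans ?_
  rw [lt_div_iff₀ hr]
  linarith

lemma logKernel_zero {d : ℕ} (hd : 1 ≤ d) (p : ℝ) : logKernel d p 0 = 0 := by
  have : (-(d:ℝ)) ≠ 0 := by
    have : (1:ℝ) ≤ d := by exact_mod_cast hd
    linarith
  simp [logKernel, Real.zero_rpow this]

lemma logKernel_nonneg {d : ℕ} {p : ℝ} {h : Fin d → ℝ} (hh : eNorm h < 1/3) :
    0 ≤ logKernel d p h := by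
  refine mul_nonneg (Real.rpow_nonneg (eNorm_nonneg h) _) (Real.rpow_nonneg ?_ _)
  rcases (eNorm_nonneg h).eq_or_lt with h0 | h0
  · simp [← h0]
  · exact (zero_lt_one.trans (log_one_div_pos h0 hh)).le

lemma lintegral_ofReal_comp_norm {d : ℕ} (hd : 1 ≤ d) {f : ℝ → ℝ} (hf : ∀ y, 0 < y → 0 ≤ f y)
    (hf0 : 0 ≤ f 0)
    (hint : IntegrableOn (fun y => y ^ (d - 1) * f y) (Set.Ioi 0)) :
    ∫⁻ x : Fin d → ℝ, ENNReal.ofReal (f ‖x‖) =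
      ENNReal.ofReal (d * 2 ^ d * ∫ y in Set.Ioi (0:ℝ), y ^ (d - 1) * f y) := by
  have : Nonempty (Fin d) := ⟨⟨0, hd⟩⟩
  have hI : Integrable (fun x : Fin d → ℝ => f ‖x‖) := by
    rw [integrable_fun_norm_addHaar volume, Module.finrank_fin_fun]
    exact hint
  have hnn : ∀ x : Fin d → ℝ, 0 ≤ f ‖x‖ := fun x => by
    rcases (norm_nonneg x).eq_or_lt with h | h
    · rwa [← h]
    · exact hf _ h
  rw [← ofReal_integral_eq_lintegral_ofReal hI (ae_of_all _ hnn),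
    integral_fun_norm_addHaar volume, Module.finrank_fin_fun, measureReal_def,
    Real.volume_pi_ball _ one_pos, Fintype.card_fin, ENNReal.toReal_ofReal (by positivity)]
  congr 1
  simp only [nsmul_eq_mul, smul_eq_mul]
  ring

lemma lintegral_indicator_Ioi_norm_rpow {d : ℕ} (hd : 1 ≤ d) {s : ℝ} (hs : 0 < s) :
    ∫⁻ x : Fin d → ℝ, ENNReal.ofReal ((Set.Ioi s).indicator (fun y => y ^ (-(3 * d / 2 : ℝ))) ‖x‖) =
      ENNReal.ofReal (2 * 2 ^ d * s ^ (-(d / 2 : ℝ))) := by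
  have hd' : (1:ℝ) ≤ d := by exact_mod_cast hd
  have heq : (fun y : ℝ => y ^ (d - 1) * (Set.Ioi s).indicator (fun y => y ^ (-(3 * d / 2 : ℝ))) y) =
      (Set.Ioi s).indicator fun y => y ^ (-(d / 2 : ℝ) - 1) := by
    funext y
    by_cases hy : y ∈ Set.Ioi s
    · have hy0 : 0 < y := hs.trans hy
      rw [Set.indicator_of_mem hy, Set.indicator_of_mem hy, ← Real.rpow_natCast, ← Real.rpow_add hy0,
        Nat.cast_sub hd]
      congr 1
      push_cast
      ring
    · rw [Set.indicator_of_notMem hy, Set.indicator_of_notMem hy, mul_zero]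
  have hlt : -(d / 2 : ℝ) - 1 < -1 := by linarith
  rw [lintegral_ofReal_comp_norm hd, heq, setIntegral_indicator measurableSet_Ioi,
    Set.inter_eq_right.2 (Set.Ioi_subset_Ioi hs.le), integral_Ioi_rpow_of_lt hlt hs]
  · congr 1
    rw [sub_add_cancel]
    have : (d:ℝ) ≠ 0 := by linarith
    field_simp
  · exact fun y hy => Set.indicator_nonneg (fun z hz => Real.rpow_nonneg (hs.trans hz).le _) _
  · exact Set.indicator_nonneg (fun z hz => Real.rpow_nonneg (hs.trans hz).le _) _
  · rw [heq]
    exact ((integrableOn_Ioi_rpow_of_lt hlt hs).integrable_indicator measurableSet_Ioi).integrableOn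

lemma lintegral_indicator_Ioo_norm_rpow {d : ℕ} (hd : 1 ≤ d) {s : ℝ} (hs : 0 < s) (hs1 : s ≤ 1) :
    ∫⁻ x : Fin d → ℝ, ENNReal.ofReal ((Set.Ioo s 1).indicator (fun y => y ^ (-(d : ℝ))) ‖x‖) =
      ENNReal.ofReal (d * 2 ^ d * Real.log (1 / s)) := by
  have hd' : (1:ℝ) ≤ d := by exact_mod_cast hd
  have heq : (fun y : ℝ => y ^ (d - 1) * (Set.Ioo s 1).indicator (fun y => y ^ (-(d : ℝ))) y) =
      (Set.Ioo s 1).indicator fun y => 1 / y := by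
    funext y
    by_cases hy : y ∈ Set.Ioo s 1
    · have hy0 : 0 < y := hs.trans hy.1
      rw [Set.indicator_of_mem hy, Set.indicator_of_mem hy, ← Real.rpow_natCast, ← Real.rpow_add hy0,
        Nat.cast_sub hd, one_div, ← Real.rpow_neg_one]
      congr 1
      push_cast
      ring
    · rw [Set.indicator_of_notMem hy, Set.indicator_of_notMem hy, mul_zero]
  have hsub : Set.Ioo s 1 ⊆ Set.Ioi 0 := fun y hy => hs.trans hy.1
  rw [lintegral_ofReal_comp_norm hd, heq, setIntegral_indicator measurableSet_Ioo,
    Set.inter_eq_right.2 hsub, ← integral_Ioc_eq_integral_Ioo, ← intervalIntegral.integral_of_le hs1,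
    integral_one_div_of_pos hs one_pos]
  · exact fun y hy => Set.indicator_nonneg (fun z hz => Real.rpow_nonneg (hs.trans hz.1).le _) _
  · exact Set.indicator_nonneg (fun z hz => Real.rpow_nonneg (hs.trans hz.1).le _) _
  · rw [heq]
    have hc : IntegrableOn (fun y : ℝ => 1 / y) (Set.Ioo s 1) := by
      have : ContinuousOn (fun y : ℝ => 1 / y) (Set.Icc s 1) :=
        ContinuousOn.div continuousOn_const continuousOn_id fun y hy => (hs.trans_le hy.1).ne'
      exact this.integrableOn_Icc.mono_set Set.Ioo_subset_Icc_self
    exact (hc.integrable_indicator measurableSet_Ioo).integrableOn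

lemma exists_setLIntegral_logKernel_le {d : ℕ} (hd : 1 ≤ d) {p : ℝ} (hp : 1 < p) :
    ∃ C : ℝ, 0 < C ∧ ∀ l : ℝ, 0 ≤ l →
      ∫⁻ h in {h : Fin d → ℝ | eNorm h < 1/3 ∧ Real.log (1 / eNorm h) < l},
        ENNReal.ofReal (logKernel d p h) ≤ ENNReal.ofReal (C * l ^ p) := by
  have hd' : (1:ℝ) ≤ d := by exact_mod_cast hd
  have hlogd : 0 ≤ Real.log d := Real.log_nonneg hd'
  refine ⟨d * 2 ^ d * (1 + Real.log d), by positivity, fun l hl => ?_⟩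
  have hem := (continuous_eNorm d).measurable
  have hlm : Measurable fun h : Fin d → ℝ => Real.log (1 / eNorm h) := by fun_prop
  have hms : MeasurableSet {h : Fin d → ℝ | eNorm h < 1/3 ∧ Real.log (1 / eNorm h) < l} :=
    (measurableSet_lt hem measurable_const).inter (measurableSet_lt hlm measurable_const)
  rcases le_or_gt l 1 with hl1 | hl1
  · refine le_trans (le_of_eq ?_) zero_le
    rw [setLIntegral_eq_zero_iff hms (measurable_logKernel d p).ennreal_ofReal]
    refine ae_of_all _ fun h hh => ?_
    by_cases h0 : h = 0
    · rw [h0, logKernel_zero hd, ENNReal.ofReal_zero]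
    · have := log_one_div_pos (eNorm_pos h0) hh.1
      linarith [hh.2]
  set s := Real.exp (-l) / d with hs
  have hs0 : 0 < s := by positivity
  have hs1 : s ≤ 1 := by
    rw [hs, div_le_one (by positivity)]
    exact (Real.exp_le_one_iff.2 (by linarith)).trans hd'
  have hlogs : Real.log (1 / s) = l + Real.log d := by
    rw [hs, one_div_div, Real.log_div (by positivity) (by positivity), Real.log_exp]
    ring
  have hl0 : 0 < l := by linarith
  calc _ ≤ ∫⁻ h in {h : Fin d → ℝ | eNorm h < 1/3 ∧ Real.log (1 / eNorm h) < l},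
        ENNReal.ofReal (l ^ (p - 1)) *
          ENNReal.ofReal ((Set.Ioo s 1).indicator (fun y => y ^ (-(d : ℝ))) ‖h‖) := by
        refine setLIntegral_mono' hms fun h hh => ?_
        rw [← ENNReal.ofReal_mul (by positivity)]
        refine ENNReal.ofReal_le_ofReal ?_
        by_cases h0 : h = 0
        · rw [h0, logKernel_zero hd]
          exact mul_nonneg (by positivity)
            (Set.indicator_nonneg (fun z hz => Real.rpow_nonneg (hs0.trans hz.1).le _) _)
        · have he := eNorm_pos h0
          have hn := norm_pos_iff.2 h0
          have hlog := log_one_div_pos he hh.1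
          have hmem : ‖h‖ ∈ Set.Ioo s 1 := by
            refine ⟨?_, ?_⟩
            · rw [hs, div_lt_iff₀ (by positivity), mul_comm]
              refine lt_of_lt_of_le ?_ (eNorm_le_mul_norm h)
              have := hh.2
              rw [one_div, Real.log_inv] at this
              rw [← Real.lt_log_iff_exp_lt he]
              linarith
            · have := hh.1
              linarith [norm_le_eNorm h]
          rw [Set.indicator_of_mem hmem, mul_comm, logKernel]
          have h1 : eNorm h ^ (-(d:ℝ)) ≤ ‖h‖ ^ (-(d:ℝ)) :=
            Real.rpow_le_rpow_of_nonpos hn (norm_le_eNorm h) (by linarith)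
          have h2 : Real.log (1 / eNorm h) ^ (p - 1) ≤ l ^ (p - 1) :=
            Real.rpow_le_rpow (by linarith) hh.2.le (by linarith)
          have h3 : 0 ≤ Real.log (1 / eNorm h) ^ (p - 1) := Real.rpow_nonneg (by linarith) _
          gcongr
    _ ≤ ∫⁻ h : Fin d → ℝ, ENNReal.ofReal (l ^ (p - 1)) *
          ENNReal.ofReal ((Set.Ioo s 1).indicator (fun y => y ^ (-(d : ℝ))) ‖h‖) :=
        setLIntegral_le_lintegral _ _
    _ = ENNReal.ofReal (l ^ (p - 1) * (d * 2 ^ d * (l + Real.log d))) := by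
        rw [lintegral_const_mul' _ _ ENNReal.ofReal_ne_top,
          lintegral_indicator_Ioo_norm_rpow hd hs0 hs1, hlogs,
          ← ENNReal.ofReal_mul (by positivity)]
    _ ≤ _ := by
        refine ENNReal.ofReal_le_ofReal ?_
        have h1 : l ^ p = l ^ (p - 1) * l := by
          rw [← Real.rpow_add_one hl0.ne']
          congr 1
          ring
        rw [h1]
        have h2 : l + Real.log d ≤ (1 + Real.log d) * l := by nlinarith
        calc _ ≤ l ^ (p - 1) * (d * 2 ^ d * ((1 + Real.log d) * l)) := by gcongr
          _ = _ := by ring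

lemma exists_setLIntegral_logKernel_mul_le {d : ℕ} (hd : 1 ≤ d) {p : ℝ} (hp : 1 < p) :
    ∃ C : ℝ, 0 < C ∧ ∀ z : Fin d → ℝ, z ≠ 0 → eNorm z < 1/3 →
      ∫⁻ h in {h : Fin d → ℝ | eNorm h < 1/3 ∧ eNorm z ^ 2 < eNorm h},
        ENNReal.ofReal (logKernel d p h * eNorm h ^ (-(d / 2 : ℝ))) ≤
          ENNReal.ofReal (C * logKernel d p z) := by
  have hd' : (1:ℝ) ≤ d := by exact_mod_cast hd
  refine ⟨2 ^ (p - 1) * (2 * 2 ^ d * (d : ℝ) ^ (d / 2 : ℝ)), by positivity, fun z hz0 hz => ?_⟩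
  have hem := (continuous_eNorm d).measurable
  have hms : MeasurableSet {h : Fin d → ℝ | eNorm h < 1/3 ∧ eNorm z ^ 2 < eNorm h} :=
    (measurableSet_lt hem measurable_const).inter (measurableSet_lt measurable_const hem)
  have hez := eNorm_pos hz0
  have hlz := log_one_div_pos hez hz
  set s := eNorm z ^ 2 / d with hs
  have hs0 : 0 < s := by positivity
  set c := (2 * Real.log (1 / eNorm z)) ^ (p - 1) with hc
  have hc0 : 0 ≤ c := Real.rpow_nonneg (by linarith) _
  calc _ ≤ ∫⁻ h in {h : Fin d → ℝ | eNorm h < 1/3 ∧ eNorm z ^ 2 < eNorm h}, ENNReal.ofReal c *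
          ENNReal.ofReal ((Set.Ioi s).indicator (fun y => y ^ (-(3 * d / 2 : ℝ))) ‖h‖) := by
        refine setLIntegral_mono' hms fun h hh => ?_
        rw [← ENNReal.ofReal_mul hc0]
        refine ENNReal.ofReal_le_ofReal ?_
        have he : 0 < eNorm h := (by positivity : 0 < eNorm z ^ 2).trans hh.2
        have h0 : h ≠ 0 := by rintro rfl; simp at he
        have hn := norm_pos_iff.2 h0
        have hmem : ‖h‖ ∈ Set.Ioi s := by
          rw [Set.mem_Ioi, hs, div_lt_iff₀ (by positivity), mul_comm]
          exact hh.2.trans_le (eNorm_le_mul_norm h)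
        have hlog := log_one_div_pos he hh.1
        rw [Set.indicator_of_mem hmem, logKernel]
        have h1 : eNorm h ^ (-(3 * d / 2 : ℝ)) ≤ ‖h‖ ^ (-(3 * d / 2 : ℝ)) :=
          Real.rpow_le_rpow_of_nonpos hn (norm_le_eNorm h) (by linarith)
        have h2 : Real.log (1 / eNorm h) ≤ 2 * Real.log (1 / eNorm z) := by
          rw [one_div, one_div, Real.log_inv, Real.log_inv]
          have := Real.log_le_log (by positivity) hh.2.le
          rw [Real.log_pow] at this
          push_cast at this
          linarith
        have h3 : Real.log (1 / eNorm h) ^ (p - 1) ≤ c :=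
          Real.rpow_le_rpow (by linarith) h2 (by linarith)
        have h4 : eNorm h ^ (-(d:ℝ)) * eNorm h ^ (-(d / 2 : ℝ)) = eNorm h ^ (-(3 * d / 2 : ℝ)) := by
          rw [← Real.rpow_add he]
          congr 1
          ring
        calc _ = Real.log (1 / eNorm h) ^ (p - 1) * eNorm h ^ (-(3 * d / 2 : ℝ)) := by
              rw [← h4]; ring
          _ ≤ _ := by gcongr
    _ ≤ ∫⁻ h : Fin d → ℝ, ENNReal.ofReal c *
          ENNReal.ofReal ((Set.Ioi s).indicator (fun y => y ^ (-(3 * d / 2 : ℝ))) ‖h‖) :=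
        setLIntegral_le_lintegral _ _
    _ = ENNReal.ofReal (c * (2 * 2 ^ d * s ^ (-(d / 2 : ℝ)))) := by
        rw [lintegral_const_mul' _ _ ENNReal.ofReal_ne_top,
          lintegral_indicator_Ioi_norm_rpow hd hs0, ENNReal.ofReal_mul hc0]
    _ = _ := by
        congr 1
        have h1 : s ^ (-(d / 2 : ℝ)) = (d : ℝ) ^ (d / 2 : ℝ) * eNorm z ^ (-(d : ℝ)) := by
          rw [hs, Real.div_rpow (by positivity) (by positivity), ← Real.rpow_natCast,
            ← Real.rpow_mul hez.le, Real.rpow_neg (by positivity : (0:ℝ) ≤ d), div_inv_eq_mul, mul_comm]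
          congr 2
          push_cast
          ring
        rw [h1, hc, logKernel, Real.mul_rpow (by norm_num) (by linarith)]
        ring

/-- The squared `L²` size of the increment of `f` by `h` on the torus. -/
def incr {d : ℕ} (f : (Fin d → ℝ) → ℝ) (h : Fin d → ℝ) : ℝ≥0∞ :=
  ∫⁻ x in box d, ENNReal.ofReal ((f (x + h) - f x) ^ 2)

lemma measurable_incr {d : ℕ} {f : (Fin d → ℝ) → ℝ} (hf : Measurable f) : Measurable (incr f) := by
  unfold incr
  refine Measurable.lintegral_prod_right'
    (f := fun q : (Fin d → ℝ) × (Fin d → ℝ) => ENNReal.ofReal ((f (q.2 + q.1) - f q.2) ^ 2)) ?_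
  fun_prop

lemma measurableSet_eNorm_lt (d : ℕ) (r : ℝ) : MeasurableSet {h : Fin d → ℝ | eNorm h < r} :=
  measurableSet_lt (continuous_eNorm d).measurable measurable_const

lemma logSeminormSqB_eq {d : ℕ} (p : ℝ) (f : (Fin d → ℝ) → ℝ) :
    logSeminormSqB d p f =
      ∫⁻ h in {h : Fin d → ℝ | eNorm h < 1/3}, ENNReal.ofReal (logKernel d p h) * incr f h := by
  refine setLIntegral_congr_fun (measurableSet_eNorm_lt d _) fun h hh => ?_
  rw [incr, ← lintegral_const_mul' _ _ ENNReal.ofReal_ne_top]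
  refine lintegral_congr fun x => ?_
  rw [sq_abs, mul_comm, ← ENNReal.ofReal_mul (logKernel_nonneg hh), logKernel]

lemma incr_zero {d : ℕ} (f : (Fin d → ℝ) → ℝ) : incr f 0 = 0 := by simp [incr]

lemma incr_nsmul_le {d : ℕ} {f : (Fin d → ℝ) → ℝ} (hf : Measurable f) (hper : IsPeriodic f)
    (m : ℕ) (z : Fin d → ℝ) : incr f ((m : ℝ) • z) ≤ ENNReal.ofReal (m ^ 2) * incr f z := by
  have key (x : Fin d → ℝ) : (f (x + (m : ℝ) • z) - f x) ^ 2 ≤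
      m * ∑ i ∈ Finset.range m, (f ((x + (i : ℝ) • z) + z) - f (x + (i : ℝ) • z)) ^ 2 := by
    have h1 : f (x + (m : ℝ) • z) - f x =
        ∑ i ∈ Finset.range m, (f ((x + (i : ℝ) • z) + z) - f (x + (i : ℝ) • z)) := by
      have := Finset.sum_range_sub (fun i : ℕ => f (x + (i : ℝ) • z)) m
      simp only [Nat.cast_zero, zero_smul, add_zero] at this
      rw [← this]
      refine Finset.sum_congr rfl fun i _ => ?_
      rw [Nat.cast_add, Nat.cast_one, add_smul, one_smul, add_assoc]
    rw [h1]
    simpa using sq_sum_le_card_mul_sum_sq (s := Finset.range m)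
      (f := fun i : ℕ => f ((x + (i : ℝ) • z) + z) - f (x + (i : ℝ) • z))
  calc incr f ((m : ℝ) • z)
      ≤ ∫⁻ x in box d, ENNReal.ofReal m * ∑ i ∈ Finset.range m,
          ENNReal.ofReal ((f ((x + (i : ℝ) • z) + z) - f (x + (i : ℝ) • z)) ^ 2) := by
        refine lintegral_mono fun x => ?_
        rw [← ENNReal.ofReal_sum_of_nonneg fun i _ => sq_nonneg _,
          ← ENNReal.ofReal_mul (by positivity)]
        exact ENNReal.ofReal_le_ofReal (key x)
    _ = ENNReal.ofReal m * ∑ i ∈ Finset.range m, incr f z := by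
        rw [lintegral_const_mul' _ _ ENNReal.ofReal_ne_top, lintegral_finsetSum _ (by fun_prop)]
        congr 1
        refine Finset.sum_congr rfl fun i _ => ?_
        refine setLIntegral_box_comp_add (F := fun x => ENNReal.ofReal ((f (x + z) - f x) ^ 2)) ?_ _
        intro x k
        dsimp only
        rw [hper, add_right_comm, hper]
    _ = _ := by
        rw [Finset.sum_const, Finset.card_range, nsmul_eq_mul, ← mul_assoc, sq,
          ENNReal.ofReal_mul (by positivity), ENNReal.ofReal_natCast]

lemma setLIntegral_ball_incr_le {d : ℕ} {f : (Fin d → ℝ) → ℝ} (hf : Measurable f)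
    (hper : IsPeriodic f) {m : ℕ} (hm : 0 < m) (R : ℝ) :
    ∫⁻ z in Metric.ball 0 R, incr f z ≤
      ENNReal.ofReal (m ^ (d + 2)) * ∫⁻ z in Metric.ball 0 (R / m), incr f z := by
  have hm' : (0:ℝ) < m := by exact_mod_cast hm
  have h1 := setLIntegral_ball_comp_smul (measurable_incr hf) (R / m) hm'
  rw [mul_div_cancel₀ _ hm'.ne'] at h1
  have h2 : ENNReal.ofReal ((m:ℝ) ^ d) ≠ 0 := by
    rw [Ne, ENNReal.ofReal_eq_zero, not_le]; positivity
  calc _ = ENNReal.ofReal ((m:ℝ) ^ d) * ∫⁻ w in Metric.ball 0 (R / m), incr f ((m:ℝ) • w) := by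
        rw [h1, ← mul_assoc, ENNReal.mul_inv_cancel h2 ENNReal.ofReal_ne_top, one_mul]
    _ ≤ ENNReal.ofReal ((m:ℝ) ^ d) * ∫⁻ w in Metric.ball 0 (R / m),
          ENNReal.ofReal (m ^ 2) * incr f w := by
        gcongr with w
        exact incr_nsmul_le hf hper m w
    _ = _ := by
        rw [lintegral_const_mul' _ _ ENNReal.ofReal_ne_top, ← mul_assoc,
          ← ENNReal.ofReal_mul (by positivity), ← pow_add]

/-- The unnormalised mean square oscillation of `f` around its value at `y` on a ball. -/
def osc {d : ℕ} (f : (Fin d → ℝ) → ℝ) (R : ℝ) (y : Fin d → ℝ) : ℝ≥0∞ :=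
  ∫⁻ z in Metric.ball 0 R, ENNReal.ofReal ((f (y + z) - f y) ^ 2)

lemma measurable_osc {d : ℕ} {f : (Fin d → ℝ) → ℝ} (hf : Measurable f) (R : ℝ) :
    Measurable (osc f R) := by
  unfold osc
  refine Measurable.lintegral_prod_right'
    (f := fun q : (Fin d → ℝ) × (Fin d → ℝ) => ENNReal.ofReal ((f (q.1 + q.2) - f q.1) ^ 2)) ?_
  fun_prop

lemma isPeriodic_osc {d : ℕ} {f : (Fin d → ℝ) → ℝ} (hper : IsPeriodic f) (R : ℝ) :
    IsPeriodic (osc f R) := by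
  intro x k
  simp only [osc]
  refine lintegral_congr fun z => ?_
  rw [hper, add_right_comm, hper]

lemma setLIntegral_box_osc {d : ℕ} {f : (Fin d → ℝ) → ℝ} (hf : Measurable f) (R : ℝ) :
    ∫⁻ y in box d, osc f R y = ∫⁻ z in Metric.ball 0 R, incr f z := by
  unfold osc incr
  refine lintegral_lintegral_swap (Measurable.aemeasurable ?_)
  simp only [Function.uncurry_def]
  fun_prop

lemma ofReal_pow_mul_sq_sub_le {d : ℕ} {f : (Fin d → ℝ) → ℝ} (hf : Measurable f) {R : ℝ}
    (hR : 0 < R) {y y' : Fin d → ℝ} (hy : ‖y - y'‖ ≤ R) :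
    ENNReal.ofReal (R ^ d) * ENNReal.ofReal ((f y - f y') ^ 2) ≤
      2 * osc f R y + 2 * osc f R y' := by
  set c := (2⁻¹ : ℝ) • (y + y') with hc
  have hsub {u : Fin d → ℝ} (hu : ‖c - u‖ ≤ R / 2) :
      Metric.ball c (R / 2) ⊆ Metric.ball u R := by
    refine Metric.ball_subset_ball' ?_
    rw [dist_eq_norm]
    linarith
  have hosc (u : Fin d → ℝ) :
      osc f R u = ∫⁻ w in Metric.ball u R, ENNReal.ofReal ((f w - f u) ^ 2) := by
    have := setLIntegral_ball_comp_add (fun w => ENNReal.ofReal ((f w - f u) ^ 2)) u 0 R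
    rwa [add_zero] at this
  have h1 : c - y = (2⁻¹ : ℝ) • (y' - y) := by
    rw [hc]; module
  have h2 : c - y' = (2⁻¹ : ℝ) • (y - y') := by
    rw [hc]; module
  have hy1 : ‖c - y‖ ≤ R / 2 := by
    rw [h1, norm_smul, norm_sub_rev, Real.norm_of_nonneg (by norm_num)]
    linarith
  have hy2 : ‖c - y'‖ ≤ R / 2 := by
    rw [h2, norm_smul, Real.norm_of_nonneg (by norm_num)]
    linarith
  have hvol : volume (Metric.ball c (R / 2)) = ENNReal.ofReal (R ^ d) := by
    rw [Real.volume_pi_ball _ (by positivity), Fintype.card_fin]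
    congr 2
    ring
  calc _ = ∫⁻ _w in Metric.ball c (R / 2), ENNReal.ofReal ((f y - f y') ^ 2) := by
        rw [setLIntegral_const, hvol, mul_comm]
    _ ≤ ∫⁻ w in Metric.ball c (R / 2), (2 * ENNReal.ofReal ((f w - f y) ^ 2) +
          2 * ENNReal.ofReal ((f w - f y') ^ 2)) := by
        refine lintegral_mono fun w => ?_
        rw [← ENNReal.ofReal_ofNat, ← ENNReal.ofReal_mul (by norm_num),
          ← ENNReal.ofReal_mul (by norm_num), ← ENNReal.ofReal_add (by positivity) (by positivity)]
        refine ENNReal.ofReal_le_ofReal ?_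
        nlinarith [sq_nonneg (f w - f y + (f w - f y'))]
    _ = 2 * (∫⁻ w in Metric.ball c (R / 2), ENNReal.ofReal ((f w - f y) ^ 2)) +
          2 * ∫⁻ w in Metric.ball c (R / 2), ENNReal.ofReal ((f w - f y') ^ 2) := by
        rw [lintegral_add_left (by fun_prop), lintegral_const_mul _ (by fun_prop),
          lintegral_const_mul _ (by fun_prop)]
    _ ≤ _ := by
        rw [hosc, hosc]
        gcongr
        · exact hsub hy1
        · exact hsub hy2

lemma incr_comp_le {d : ℕ} {f : (Fin d → ℝ) → ℝ} (hf : Measurable f) (hper : IsPeriodic f)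
    {Θ : ℝ} (hΘ : ∀ x, |f x| ≤ Θ) {Y : (Fin d → ℝ) → (Fin d → ℝ)} (hY : Measurable Y)
    (hYper : ∀ x (k : Fin d → ℤ), Y (x + fun i => (k i : ℝ)) = Y x + fun i => (k i : ℝ))
    {g : (Fin d → ℝ) → ℝ} (hg : Measurable g) (hgper : IsPeriodic g)
    (hlip : ∀ x y, ‖Y x - Y y‖ ≤ ‖x - y‖ * Real.exp (g x + g y)) {J : ℝ≥0∞}
    (hJ : ∀ F : (Fin d → ℝ) → ℝ≥0∞, IsPeriodic F →
      ∫⁻ x in box d, F (Y x) ≤ J * ∫⁻ x in box d, F x)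
    {m : ℕ} (hm : 0 < m) {h : Fin d → ℝ} (h0 : h ≠ 0) :
    incr (fun x => f (Y x)) h ≤
      ENNReal.ofReal (8 * Θ ^ 2) * (∫⁻ x in box d,
        {x | Real.log (1 / eNorm h) < 4 * g x}.indicator 1 x) +
      ENNReal.ofReal (4 * m ^ (d + 2) * eNorm h ^ (-(d / 2 : ℝ))) * (J *
        ∫⁻ z in Metric.ball 0 (√(eNorm h) / m), incr f z) := by
  have hr := eNorm_pos h0
  set r := eNorm h with hrdef
  set R := √r with hR
  have hR0 : 0 < R := Real.sqrt_pos.2 hr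
  set I : (Fin d → ℝ) → ℝ≥0∞ := {x | Real.log (1 / r) < 4 * g x}.indicator 1 with hI
  have hIper : IsPeriodic I := by
    intro x k
    simp only [hI, Set.indicator, Set.mem_ofPred_eq, hgper x k, Pi.one_apply]
  have hIm : Measurable I :=
    measurable_one.indicator (measurableSet_lt measurable_const (by fun_prop))
  have hoscper : IsPeriodic fun x => osc f R (Y x) := by
    intro x k
    dsimp only
    rw [hYper, isPeriodic_osc hper R]
  have hoscm : Measurable fun x => osc f R (Y x) := (measurable_osc hf R).comp hY
  have hRd : ENNReal.ofReal (R ^ d) ≠ 0 := by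
    rw [Ne, ENNReal.ofReal_eq_zero, not_le]; positivity
  have key (x : Fin d → ℝ) : ENNReal.ofReal ((f (Y (x + h)) - f (Y x)) ^ 2) ≤
      ENNReal.ofReal (4 * Θ ^ 2) * (I x + I (x + h)) +
        (ENNReal.ofReal (R ^ d))⁻¹ * (2 * osc f R (Y (x + h)) + 2 * osc f R (Y x)) := by
    by_cases hx : g x + g (x + h) ≤ Real.log (1 / r) / 2
    · refine le_trans ?_ le_add_self
      rw [mul_comm, ← div_eq_mul_inv, ENNReal.le_div_iff_mul_le (Or.inl hRd)
        (Or.inl ENNReal.ofReal_ne_top), mul_comm]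
      refine ofReal_pow_mul_sq_sub_le hf hR0 ((hlip _ _).trans ?_)
      have h1 : Real.exp (g (x + h) + g x) ≤ R⁻¹ := by
        rw [← Real.exp_log (inv_pos.2 hR0), Real.exp_le_exp, Real.log_inv, hR,
          Real.log_sqrt hr.le, add_comm]
        rw [one_div, Real.log_inv] at hx
        linarith
      calc ‖x + h - x‖ * Real.exp (g (x + h) + g x) ≤ r * R⁻¹ := by
            rw [add_sub_cancel_left]
            gcongr
            exact norm_le_eNorm h
        _ = R := by
            rw [← div_eq_mul_inv, div_eq_iff hR0.ne', hR, Real.mul_self_sqrt hr.le]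
    · refine le_trans ?_ le_self_add
      have h1 : (1 : ℝ≥0∞) ≤ I x + I (x + h) := by
        rw [not_le] at hx
        by_cases h2 : Real.log (1 / r) < 4 * g x
        · refine le_trans ?_ le_self_add
          rw [hI, Set.indicator_of_mem (Set.mem_ofPred_eq ▸ h2), Pi.one_apply]
        · refine le_trans ?_ le_add_self
          have h3 : x + h ∈ {x | Real.log (1 / r) < 4 * g x} := by
            rw [Set.mem_ofPred_eq]
            linarith
          rw [hI, Set.indicator_of_mem h3, Pi.one_apply]
      refine le_trans (ENNReal.ofReal_le_ofReal ?_) (le_mul_of_one_le_right' h1)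
      have h4 : |f (Y (x + h)) - f (Y x)| ≤ 2 * Θ :=
        (abs_sub _ _).trans (by linarith [hΘ (Y (x + h)), hΘ (Y x)])
      calc (f (Y (x + h)) - f (Y x)) ^ 2 = |f (Y (x + h)) - f (Y x)| ^ 2 := (sq_abs _).symm
        _ ≤ (2 * Θ) ^ 2 := by gcongr
        _ = 4 * Θ ^ 2 := by ring
  calc incr (fun x => f (Y x)) h ≤ ∫⁻ x in box d, (ENNReal.ofReal (4 * Θ ^ 2) * (I x + I (x + h)) +
        (ENNReal.ofReal (R ^ d))⁻¹ * (2 * osc f R (Y (x + h)) + 2 * osc f R (Y x))) :=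
        lintegral_mono key
    _ = ENNReal.ofReal (4 * Θ ^ 2) * ((∫⁻ x in box d, I x) + ∫⁻ x in box d, I (x + h)) +
        (ENNReal.ofReal (R ^ d))⁻¹ * (2 * (∫⁻ x in box d, osc f R (Y (x + h))) +
          2 * ∫⁻ x in box d, osc f R (Y x)) := by
        have hoscm' : Measurable fun x => osc f R (Y (x + h)) :=
          hoscm.comp (measurable_id.add_const h)
        have hIm' : Measurable fun x => I (x + h) := hIm.comp (measurable_id.add_const h)
        rw [lintegral_add_left (by fun_prop), lintegral_const_mul _ (by fun_prop),
          lintegral_const_mul _ (by fun_prop), lintegral_add_left hIm,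
          lintegral_add_left (by fun_prop), lintegral_const_mul _ hoscm',
          lintegral_const_mul _ hoscm]
    _ = ENNReal.ofReal (8 * Θ ^ 2) * (∫⁻ x in box d, I x) +
        4 * (ENNReal.ofReal (R ^ d))⁻¹ * ∫⁻ x in box d, osc f R (Y x) := by
        have h5 : ENNReal.ofReal (8 * Θ ^ 2) = 2 * ENNReal.ofReal (4 * Θ ^ 2) := by
          rw [← ENNReal.ofReal_ofNat, ← ENNReal.ofReal_mul (by norm_num)]
          ring_nf
        rw [setLIntegral_box_comp_add hIper, setLIntegral_box_comp_add hoscper, h5]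
        ring
    _ ≤ ENNReal.ofReal (8 * Θ ^ 2) * (∫⁻ x in box d, I x) +
        4 * (ENNReal.ofReal (R ^ d))⁻¹ * (J * (ENNReal.ofReal (m ^ (d + 2)) *
          ∫⁻ z in Metric.ball 0 (R / m), incr f z)) := by
        gcongr
        refine (hJ _ (isPeriodic_osc hper R)).trans ?_
        rw [setLIntegral_box_osc hf]
        gcongr
        exact setLIntegral_ball_incr_le hf hper hm R
    _ = _ := by
        have h5 : (R ^ d)⁻¹ = r ^ (-(d / 2 : ℝ)) := by
          rw [Real.rpow_neg hr.le, hR, Real.sqrt_eq_rpow, ← Real.rpow_natCast, ← Real.rpow_mul hr.le]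
          congr 2
          ring
        have h6 : ENNReal.ofReal (4 * m ^ (d + 2) * r ^ (-(d / 2 : ℝ))) =
            4 * ENNReal.ofReal (m ^ (d + 2)) * ENNReal.ofReal (r ^ (-(d / 2 : ℝ))) := by
          rw [ENNReal.ofReal_mul (by positivity), ENNReal.ofReal_mul (by positivity),
            ENNReal.ofReal_ofNat]
        rw [← ENNReal.ofReal_inv_of_pos (by positivity), h5, h6]
        ring

lemma setLIntegral_logKernel_mul_lintegral_indicator_le {d : ℕ} {p : ℝ} {C : ℝ} (hC : 0 ≤ C)
    (hK : ∀ l : ℝ, 0 ≤ l →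
      ∫⁻ h in {h : Fin d → ℝ | eNorm h < 1/3 ∧ Real.log (1 / eNorm h) < l},
        ENNReal.ofReal (logKernel d p h) ≤ ENNReal.ofReal (C * l ^ p))
    {g : (Fin d → ℝ) → ℝ} (hg : Measurable g) (hg0 : ∀ x, 0 ≤ g x) :
    ∫⁻ h in {h : Fin d → ℝ | eNorm h < 1/3}, ENNReal.ofReal (logKernel d p h) *
      (∫⁻ x in box d, {x | Real.log (1 / eNorm h) < 4 * g x}.indicator 1 x) ≤
      ENNReal.ofReal (C * 4 ^ p) * ∫⁻ x in box d, ENNReal.ofReal (g x ^ p) := by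
  have hem := (continuous_eNorm d).measurable
  have hlm : Measurable fun h : Fin d → ℝ => Real.log (1 / eNorm h) := by fun_prop
  have hKm := (measurable_logKernel d p).ennreal_ofReal
  set S : Set ((Fin d → ℝ) × (Fin d → ℝ)) := {q | Real.log (1 / eNorm q.1) < 4 * g q.2} with hS
  have hSm : MeasurableSet S :=
    measurableSet_lt (hlm.comp measurable_fst) ((hg.comp measurable_snd).const_mul 4)
  calc _ = ∫⁻ h in {h : Fin d → ℝ | eNorm h < 1/3}, ∫⁻ x in box d,
        ENNReal.ofReal (logKernel d p h) * S.indicator 1 (h, x) := by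
        refine lintegral_congr fun h => ?_
        rw [← lintegral_const_mul' _ _ ENNReal.ofReal_ne_top]
        rfl
    _ = ∫⁻ x in box d, ∫⁻ h in {h : Fin d → ℝ | eNorm h < 1/3},
        ENNReal.ofReal (logKernel d p h) * S.indicator 1 (h, x) :=
        lintegral_lintegral_swap
          ((hKm.comp measurable_fst).mul (measurable_one.indicator hSm)).aemeasurable
    _ ≤ ∫⁻ x in box d, ENNReal.ofReal (C * 4 ^ p) * ENNReal.ofReal (g x ^ p) := by
        refine lintegral_mono fun x => ?_
        have h4 : (0:ℝ) ≤ 4 * g x := by linarith [hg0 x]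
        rw [← ENNReal.ofReal_mul (by positivity), mul_assoc,
          ← Real.mul_rpow (by norm_num) (hg0 x)]
        refine le_trans (le_of_eq ?_) (hK (4 * g x) h4)
        set U : Set (Fin d → ℝ) := {h | Real.log (1 / eNorm h) < 4 * g x} with hU
        have hT : MeasurableSet U := measurableSet_lt hlm measurable_const
        have hset : {h : Fin d → ℝ | eNorm h < 1/3 ∧ Real.log (1 / eNorm h) < 4 * g x} =
            U ∩ {h : Fin d → ℝ | eNorm h < 1/3} := by
          ext h; exact and_comm
        rw [hset, ← setLIntegral_indicator hT]
        refine lintegral_congr fun h => ?_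
        by_cases hh : Real.log (1 / eNorm h) < 4 * g x
        · rw [Set.indicator_of_mem (show (h, x) ∈ S from hh),
            Set.indicator_of_mem (show h ∈ U from hh), Pi.one_apply, mul_one]
        · rw [Set.indicator_of_notMem (show (h, x) ∉ S from hh),
            Set.indicator_of_notMem (show h ∉ U from hh), mul_zero]
    _ = _ := lintegral_const_mul' _ _ ENNReal.ofReal_ne_top

lemma setLIntegral_logKernel_mul_setLIntegral_incr_le {d : ℕ} (hd : 1 ≤ d) {p : ℝ} {C : ℝ}
    (hC : 0 ≤ C) (hK : ∀ z : Fin d → ℝ, z ≠ 0 → eNorm z < 1/3 →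
      ∫⁻ h in {h : Fin d → ℝ | eNorm h < 1/3 ∧ eNorm z ^ 2 < eNorm h},
        ENNReal.ofReal (logKernel d p h * eNorm h ^ (-(d / 2 : ℝ))) ≤
          ENNReal.ofReal (C * logKernel d p z))
    {f : (Fin d → ℝ) → ℝ} (hf : Measurable f) :
    ∫⁻ h in {h : Fin d → ℝ | eNorm h < 1/3},
      ENNReal.ofReal (logKernel d p h * eNorm h ^ (-(d / 2 : ℝ))) *
        ∫⁻ z in Metric.ball 0 (√(eNorm h) / (2 * d : ℕ)), incr f z ≤
      ENNReal.ofReal C * logSeminormSqB d p f := by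
  have hd' : (1:ℝ) ≤ d := by exact_mod_cast hd
  have hem := (continuous_eNorm d).measurable
  have hKm : Measurable fun h : Fin d → ℝ =>
      ENNReal.ofReal (logKernel d p h * eNorm h ^ (-(d / 2 : ℝ))) := by
    have := measurable_logKernel d p
    fun_prop
  set S : Set ((Fin d → ℝ) × (Fin d → ℝ)) := {q | ‖q.2‖ < √(eNorm q.1) / (2 * d : ℕ)} with hS
  have hSm : MeasurableSet S := measurableSet_lt (by fun_prop) (by fun_prop)
  have him := measurable_incr hf
  set B : Set (Fin d → ℝ) := {h : Fin d → ℝ | eNorm h < 1/3} with hB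
  have hBm : MeasurableSet B := measurableSet_eNorm_lt d _
  set w : (Fin d → ℝ) → ℝ≥0∞ := fun h =>
      ENNReal.ofReal (logKernel d p h * eNorm h ^ (-(d / 2 : ℝ)))
  calc _ = ∫⁻ h in B, ∫⁻ z, w h * S.indicator (fun q => incr f q.2) (h, z) := by
        refine lintegral_congr fun h => ?_
        rw [← lintegral_indicator measurableSet_ball, ← lintegral_const_mul' _ _ ENNReal.ofReal_ne_top]
        refine lintegral_congr fun z => ?_
        congr 1
        by_cases hz : ‖z‖ < √(eNorm h) / (2 * d : ℕ)
        · rw [Set.indicator_of_mem (mem_ball_zero_iff.2 hz),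
            Set.indicator_of_mem (show (h, z) ∈ S from hz)]
        · rw [Set.indicator_of_notMem (mt mem_ball_zero_iff.1 hz),
            Set.indicator_of_notMem (show (h, z) ∉ S from hz)]
    _ = ∫⁻ z, ∫⁻ h in B, w h * S.indicator (fun q => incr f q.2) (h, z) :=
        lintegral_lintegral_swap ((hKm.comp measurable_fst).mul
          ((him.comp measurable_snd).indicator hSm)).aemeasurable
    _ ≤ ∫⁻ z, B.indicator (fun z => ENNReal.ofReal C *
          (ENNReal.ofReal (logKernel d p z) * incr f z)) z := by
        refine lintegral_mono fun z => ?_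
        dsimp only
        by_cases hz0 : z = 0
        · refine le_trans (le_of_eq ?_) zero_le
          rw [lintegral_eq_zero_iff']
          · refine ae_of_all _ fun h => ?_
            by_cases hh : (h, z) ∈ S
            · simp [hz0, incr_zero]
            · simp [Set.indicator_of_notMem hh]
          · exact (hKm.mul (((him.comp measurable_snd).indicator hSm).comp
              measurable_prodMk_right)).aemeasurable
        have hSz {h : Fin d → ℝ} (hh : h ∈ B) (hz : (h, z) ∈ S) :
            eNorm z < 1/3 ∧ eNorm z ^ 2 < eNorm h := by
          have h1 : ‖z‖ < √(eNorm h) / (2 * d : ℕ) := hz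
          have h2 : eNorm z < √(eNorm h) / 2 := by
            refine (eNorm_le_mul_norm z).trans_lt ?_
            push_cast at h1
            rw [lt_div_iff₀ (by positivity)] at h1
            linarith
          have h3 := Real.sq_sqrt (eNorm_nonneg h)
          have h4 := Real.sqrt_nonneg (eNorm h)
          have h5 : eNorm h < 1/3 := hh
          have h6 := eNorm_pos hz0
          constructor
          · nlinarith
          · nlinarith
        by_cases hzB : z ∈ B
        · rw [Set.indicator_of_mem hzB]
          set U : Set (Fin d → ℝ) := {h | eNorm z ^ 2 < eNorm h} with hU
          have hT : MeasurableSet U := measurableSet_lt measurable_const hem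
          calc _ ≤ ∫⁻ h in B, U.indicator w h * incr f z := by
                refine setLIntegral_mono' hBm fun h hh => ?_
                by_cases hS' : (h, z) ∈ S
                · rw [Set.indicator_of_mem hS',
                    Set.indicator_of_mem (show h ∈ U from (hSz hh hS').2)]
                · rw [Set.indicator_of_notMem hS', mul_zero]
                  exact zero_le
            _ = (∫⁻ h in {h : Fin d → ℝ | eNorm h < 1/3 ∧ eNorm z ^ 2 < eNorm h}, w h) *
                  incr f z := by
                rw [lintegral_mul_const _ (hKm.indicator hT), setLIntegral_indicator hT,
                  Set.inter_comm]
                rfl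
            _ ≤ ENNReal.ofReal (C * logKernel d p z) * incr f z := by
                gcongr
                exact hK z hz0 hzB
            _ = _ := by rw [ENNReal.ofReal_mul hC, mul_assoc]
        · refine le_trans (le_of_eq ?_) zero_le
          rw [setLIntegral_eq_zero_iff hBm]
          · refine ae_of_all _ fun h hh => ?_
            rw [Set.indicator_of_notMem fun hS' => hzB (hSz hh hS').1, mul_zero]
          · exact hKm.mul (((him.comp measurable_snd).indicator hSm).comp measurable_prodMk_right)
    _ = _ := by
        rw [lintegral_indicator hBm, lintegral_const_mul' _ _ ENNReal.ofReal_ne_top,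
          logSeminormSqB_eq]

lemma exists_logSeminormSqB_comp_le {d : ℕ} (hd : 1 ≤ d) {p : ℝ} (hp : 1 < p) :
    ∃ C : ℝ, 0 < C ∧ ∀ (f : (Fin d → ℝ) → ℝ) (Y : (Fin d → ℝ) → (Fin d → ℝ))
      (g : (Fin d → ℝ) → ℝ) (Θ J : ℝ), Measurable f → IsPeriodic f →
      (∀ x, |f x| ≤ Θ) → Measurable Y →
      (∀ x (k : Fin d → ℤ), Y (x + fun i => (k i : ℝ)) = Y x + fun i => (k i : ℝ)) →
      Measurable g → (∀ x, 0 ≤ g x) → IsPeriodic g →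
      (∀ x y, ‖Y x - Y y‖ ≤ ‖x - y‖ * Real.exp (g x + g y)) →
      (∀ F : (Fin d → ℝ) → ℝ≥0∞, IsPeriodic F →
        ∫⁻ x in box d, F (Y x) ≤ ENNReal.ofReal J * ∫⁻ x in box d, F x) →
      logSeminormSqB d p (fun x => f (Y x)) ≤ ENNReal.ofReal C *
        (ENNReal.ofReal (Θ ^ 2) * (∫⁻ x in box d, ENNReal.ofReal (g x ^ p)) +
          ENNReal.ofReal J * logSeminormSqB d p f) := by
  obtain ⟨C₁, hC₁, h₁⟩ := exists_setLIntegral_logKernel_le hd hp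
  obtain ⟨C₂, hC₂, h₂⟩ := exists_setLIntegral_logKernel_mul_le hd hp
  set a : ℝ := 8 * (C₁ * 4 ^ p) with ha
  set c : ℝ := 4 * (2 * d : ℕ) ^ (d + 2) * C₂ with hc
  have ha0 : 0 < a := by positivity
  have hc0 : 0 ≤ c := by positivity
  refine ⟨a + c, by positivity, ?_⟩
  intro f Y g Θ J hf hper hΘ hY hYper hg hg0 hgper hlip hJ
  have hem := (continuous_eNorm d).measurable
  have hKm := measurable_logKernel d p
  set V : (Fin d → ℝ) → ℝ≥0∞ := fun h => ∫⁻ x in box d,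
    {x | Real.log (1 / eNorm h) < 4 * g x}.indicator 1 x with hV
  set W : (Fin d → ℝ) → ℝ≥0∞ := fun h =>
    ∫⁻ z in Metric.ball 0 (√(eNorm h) / (2 * d : ℕ)), incr f z with hW
  set w : (Fin d → ℝ) → ℝ≥0∞ := fun h =>
    ENNReal.ofReal (logKernel d p h * eNorm h ^ (-(d / 2 : ℝ))) with hw
  have hVm : Measurable V := by
    refine Measurable.lintegral_prod_right' (f := fun q : (Fin d → ℝ) × (Fin d → ℝ) =>
      {q : (Fin d → ℝ) × (Fin d → ℝ) | Real.log (1 / eNorm q.1) < 4 * g q.2}.indicator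
        (1 : (Fin d → ℝ) × (Fin d → ℝ) → ℝ≥0∞) q) ?_
    have hlm : Measurable fun h : Fin d → ℝ => Real.log (1 / eNorm h) := by fun_prop
    exact measurable_one.indicator (measurableSet_lt (hlm.comp measurable_fst)
      ((hg.comp measurable_snd).const_mul 4))
  rw [logSeminormSqB_eq]
  calc _ ≤ ∫⁻ h in {h : Fin d → ℝ | eNorm h < 1/3},
        (ENNReal.ofReal (8 * Θ ^ 2) * (ENNReal.ofReal (logKernel d p h) * V h) +
          (ENNReal.ofReal (4 * (2 * d : ℕ) ^ (d + 2)) * ENNReal.ofReal J) * (w h * W h)) := by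
        refine setLIntegral_mono' (measurableSet_eNorm_lt d _) fun h hh => ?_
        by_cases h0 : h = 0
        · rw [h0, incr_zero, mul_zero]
          exact zero_le
        have h1 := incr_comp_le hf hper hΘ hY hYper hg hgper hlip hJ (m := 2 * d) (by omega) h0
        have h2 : w h = ENNReal.ofReal (logKernel d p h) *
            ENNReal.ofReal (eNorm h ^ (-(d / 2 : ℝ))) := ENNReal.ofReal_mul (logKernel_nonneg hh)
        rw [ENNReal.ofReal_mul (p := 4 * ((2 * d : ℕ) : ℝ) ^ (d + 2)) (by positivity)] at h1
        calc _ ≤ _ := mul_le_mul_right h1 _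
          _ = _ := by
            rw [h2]
            simp only [hV, hW]
            generalize ENNReal.ofReal (8 * Θ ^ 2) = u
            generalize ENNReal.ofReal (4 * (2 * d : ℕ) ^ (d + 2)) = u'
            generalize ENNReal.ofReal (logKernel d p h) = u''
            generalize (∫⁻ x in box d, _ : ℝ≥0∞) = v
            ring
    _ ≤ ENNReal.ofReal (8 * Θ ^ 2) * (ENNReal.ofReal (C₁ * 4 ^ p) *
          ∫⁻ x in box d, ENNReal.ofReal (g x ^ p)) +
        (ENNReal.ofReal (4 * (2 * d : ℕ) ^ (d + 2)) * ENNReal.ofReal J) *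
          (ENNReal.ofReal C₂ * logSeminormSqB d p f) := by
        rw [lintegral_add_left (by fun_prop), lintegral_const_mul' _ _ ENNReal.ofReal_ne_top]
        refine add_le_add ?_ ?_
        · gcongr
          exact setLIntegral_logKernel_mul_lintegral_indicator_le hC₁.le h₁ hg hg0
        · rw [lintegral_const_mul' _ _ (by finiteness)]
          gcongr
          exact setLIntegral_logKernel_mul_setLIntegral_incr_le hd hC₂.le h₂ hf
    _ = ENNReal.ofReal a * (ENNReal.ofReal (Θ ^ 2) * ∫⁻ x in box d, ENNReal.ofReal (g x ^ p)) +
          ENNReal.ofReal c * (ENNReal.ofReal J * logSeminormSqB d p f) := by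
        rw [ha, hc, ENNReal.ofReal_mul (p := 8) (q := Θ ^ 2) (by positivity),
          ENNReal.ofReal_mul (p := 8) (by positivity),
          ENNReal.ofReal_mul (q := C₂) (by positivity)]
        generalize ENNReal.ofReal (C₁ * 4 ^ p) = u
        generalize ENNReal.ofReal (Θ ^ 2) = u'
        generalize ENNReal.ofReal (4 * (2 * d : ℕ) ^ (d + 2)) = u''
        ring
    _ ≤ ENNReal.ofReal (a + c) * (ENNReal.ofReal (Θ ^ 2) *
          ∫⁻ x in box d, ENNReal.ofReal (g x ^ p)) +
          ENNReal.ofReal (a + c) * (ENNReal.ofReal J * logSeminormSqB d p f) := by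
        gcongr
        · linarith
        · linarith
    _ = _ := by rw [mul_add]

lemma incr_le_of_abs_sub_le {d : ℕ} {f φ : (Fin d → ℝ) → ℝ} (hφ : Measurable φ)
    {η : ℝ} (hη : ∀ x, |f x - φ x| ≤ η) (h : Fin d → ℝ) :
    incr f h ≤ 2 * incr φ h + ENNReal.ofReal (8 * η ^ 2) := by
  calc incr f h ≤ ∫⁻ x in box d, (2 * ENNReal.ofReal ((φ (x + h) - φ x) ^ 2) +
        ENNReal.ofReal (8 * η ^ 2)) := by
        refine lintegral_mono fun x => ?_
        rw [← ENNReal.ofReal_ofNat, ← ENNReal.ofReal_mul (by norm_num),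
          ← ENNReal.ofReal_add (by positivity) (by positivity)]
        refine ENNReal.ofReal_le_ofReal ?_
        set u := φ (x + h) - φ x
        set e := (f (x + h) - φ (x + h)) - (f x - φ x) with he
        have h1 : |e| ≤ 2 * η := (abs_sub _ _).trans (by linarith [hη (x + h), hη x])
        have h2 : e ^ 2 ≤ 4 * η ^ 2 := by
          calc e ^ 2 = |e| ^ 2 := (sq_abs _).symm
            _ ≤ (2 * η) ^ 2 := by gcongr
            _ = _ := by ring
        have h3 : f (x + h) - f x = u + e := by ring
        rw [h3]
        nlinarith [sq_nonneg (u - e)]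
    _ = _ := by
        rw [lintegral_add_left (by fun_prop), lintegral_const_mul _ (by fun_prop),
          setLIntegral_const, volume_box, mul_one]
        rfl

lemma setLIntegral_logKernel_ne_top {d : ℕ} (hd : 1 ≤ d) {p : ℝ} (hp : 1 < p) {δ : ℝ} (hδ : 0 < δ) :
    ∫⁻ h in {h : Fin d → ℝ | δ < eNorm h ∧ eNorm h < 1/3}, ENNReal.ofReal (logKernel d p h) ≠ ∞ := by
  obtain ⟨C, -, hC⟩ := exists_setLIntegral_logKernel_le hd hp
  refine ne_top_of_le_ne_top ENNReal.ofReal_ne_top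
    (le_trans (lintegral_mono_set ?_) (hC (max (Real.log (1 / δ)) 0) (le_max_right _ _)))
  rintro h ⟨h1, h2⟩
  refine ⟨h2, lt_of_lt_of_le ?_ (le_max_left _ _)⟩
  exact Real.log_lt_log (one_div_pos.2 (hδ.trans h1)) (one_div_lt_one_div_of_lt hδ h1)

lemma logSeminormSqB_le_of_forall {d : ℕ} {p : ℝ} {f : (Fin d → ℝ) → ℝ} {R : ℝ≥0∞}
    (hR : ∀ δ : ℝ, 0 < δ → ∫⁻ h in {h : Fin d → ℝ | δ < eNorm h ∧ eNorm h < 1/3},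
      ENNReal.ofReal (logKernel d p h) * incr f h ≤ R) :
    logSeminormSqB d p f ≤ R := by
  have hem := (continuous_eNorm d).measurable
  set s : ℕ → Set (Fin d → ℝ) := fun n => {h | 1 / ((n:ℝ) + 1) < eNorm h ∧ eNorm h < 1/3} with hs
  set w : (Fin d → ℝ) → ℝ≥0∞ := fun h => ENNReal.ofReal (logKernel d p h) * incr f h with hw
  have hmono : Monotone s := by
    rintro m n hmn h ⟨h1, h2⟩
    refine ⟨lt_of_le_of_lt ?_ h1, h2⟩
    gcongr
  have h1 : logSeminormSqB d p f ≤ ∫⁻ h in ⋃ n, s n, w h := by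
    have hB := measurableSet_eNorm_lt d (1/3)
    have hU : MeasurableSet (⋃ n, s n) := MeasurableSet.iUnion fun n =>
      (measurableSet_lt measurable_const hem).inter (measurableSet_lt hem measurable_const)
    rw [logSeminormSqB_eq, ← lintegral_indicator hB, ← lintegral_indicator hU]
    refine lintegral_mono fun h => ?_
    by_cases hh : h ∈ {h : Fin d → ℝ | eNorm h < 1/3}
    · rw [Set.indicator_of_mem hh]
      by_cases h0 : h = 0
      · rw [h0, incr_zero, mul_zero]
        exact zero_le
      · obtain ⟨n, hn⟩ := exists_nat_one_div_lt (eNorm_pos h0)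
        rw [Set.indicator_of_mem (Set.mem_iUnion.2 ⟨n, show h ∈ s n from ⟨hn, hh⟩⟩)]
    · rw [Set.indicator_of_notMem hh]
      exact zero_le
  refine h1.trans ?_
  rw [setLIntegral_iUnion_of_directed _ (directed_of_isDirected_le hmono)]
  exact iSup_le fun n => hR _ (by positivity)

lemma logSeminormSqB_le_of_tendsto {d : ℕ} (hd : 1 ≤ d) {p : ℝ} (hp : 1 < p)
    {f : (Fin d → ℝ) → ℝ} {η : ℕ → ℝ} {R : ℕ → ℝ≥0∞} {R₀ : ℝ≥0∞}
    (hη : Filter.Tendsto η Filter.atTop (nhds 0)) (hR : Filter.Tendsto R Filter.atTop (nhds R₀))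
    (hf : ∀ᶠ n in Filter.atTop, ∃ φ : (Fin d → ℝ) → ℝ, Measurable φ ∧
      (∀ x, |f x - φ x| ≤ η n) ∧ logSeminormSqB d p φ ≤ R n) :
    logSeminormSqB d p f ≤ 2 * R₀ := by
  refine logSeminormSqB_le_of_forall fun δ hδ => ?_
  set M := ∫⁻ h in {h : Fin d → ℝ | δ < eNorm h ∧ eNorm h < 1/3},
    ENNReal.ofReal (logKernel d p h) with hM
  have hMtop : M ≠ ∞ := setLIntegral_logKernel_ne_top hd hp hδ
  have hKm := (measurable_logKernel d p).ennreal_ofReal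
  have hlim : Filter.Tendsto (fun n => 2 * R n + M * ENNReal.ofReal (8 * η n ^ 2)) Filter.atTop
      (nhds (2 * R₀ + M * ENNReal.ofReal (8 * 0 ^ 2))) :=
    (ENNReal.Tendsto.const_mul hR (Or.inr ENNReal.ofNat_ne_top)).add
      (ENNReal.Tendsto.const_mul (ENNReal.tendsto_ofReal ((hη.pow 2).const_mul 8)) (Or.inr hMtop))
  rw [zero_pow two_ne_zero, mul_zero, ENNReal.ofReal_zero, mul_zero, add_zero] at hlim
  refine ge_of_tendsto hlim ?_
  filter_upwards [hf] with n hn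
  obtain ⟨φ, hφ, hφ1, hφ2⟩ := hn
  have him := measurable_incr hφ
  calc _ ≤ ∫⁻ h in {h : Fin d → ℝ | δ < eNorm h ∧ eNorm h < 1/3},
        (2 * (ENNReal.ofReal (logKernel d p h) * incr φ h) +
          ENNReal.ofReal (logKernel d p h) * ENNReal.ofReal (8 * η n ^ 2)) := by
        refine lintegral_mono fun h => ?_
        refine (mul_le_mul_right (incr_le_of_abs_sub_le hφ hφ1 h) _).trans (le_of_eq ?_)
        generalize ENNReal.ofReal (8 * η n ^ 2) = u
        ring
    _ = 2 * (∫⁻ h in {h : Fin d → ℝ | δ < eNorm h ∧ eNorm h < 1/3},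
          ENNReal.ofReal (logKernel d p h) * incr φ h) + M * ENNReal.ofReal (8 * η n ^ 2) := by
        rw [lintegral_add_left (by fun_prop), lintegral_const_mul _ (by fun_prop),
          lintegral_mul_const _ hKm]
    _ ≤ _ := by
        gcongr
        refine le_trans ?_ hφ2
        rw [logSeminormSqB_eq]
        exact lintegral_mono_set fun h hh => hh.2

lemma isCompact_Icc_prod_Icc (d : ℕ) (T : ℝ) :
    IsCompact (Set.Icc (0:ℝ) T ×ˢ Set.Icc (0 : Fin d → ℝ) 1) := isCompact_Icc.prod isCompact_Icc

lemma box_subset_Icc (d : ℕ) : box d ⊆ Set.Icc (0 : Fin d → ℝ) 1 := fun _ hx =>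
  ⟨fun i => (hx i (Set.mem_univ i)).1, fun i => (hx i (Set.mem_univ i)).2.le⟩

lemma exists_forall_norm_le_of_periodic {d : ℕ} {E : Type*} [NormedAddCommGroup E]
    {F : ℝ × (Fin d → ℝ) → E} (hF : Continuous F) (hper : ∀ s, IsPeriodic fun x => F (s, x))
    (T : ℝ) : ∃ L : ℝ, 0 ≤ L ∧ ∀ s ∈ Set.Icc (0:ℝ) T, ∀ x, ‖F (s, x)‖ ≤ L := by
  obtain ⟨L, hL⟩ := (isCompact_Icc_prod_Icc d T).exists_bound_of_continuousOn hF.continuousOn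
  refine ⟨max L 0, le_max_right _ _, fun s hs x => ?_⟩
  obtain ⟨k, hk⟩ := exists_add_mem_box x
  have := hper s x k
  dsimp only at this
  rw [← this]
  exact (hL _ ⟨hs, box_subset_Icc d hk⟩).trans (le_max_left _ _)

lemma exists_forall_norm_sub_le_of_periodic {d : ℕ} {E : Type*} [NormedAddCommGroup E]
    [NormedSpace ℝ E] {F : ℝ × (Fin d → ℝ) → E} (hF : ContDiff ℝ 1 F)
    (hper : ∀ s, IsPeriodic fun x => F (s, x)) (T : ℝ) :
    ∃ L : ℝ, 0 ≤ L ∧ ∀ s ∈ Set.Icc (0:ℝ) T, ∀ s' ∈ Set.Icc (0:ℝ) T, ∀ x,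
      ‖F (s, x) - F (s', x)‖ ≤ L * |s - s'| := by
  obtain ⟨L, hL⟩ := (isCompact_Icc_prod_Icc d T).exists_bound_of_continuousOn
    (hF.continuous_fderiv one_ne_zero).continuousOn
  refine ⟨max L 0, le_max_right _ _, fun s hs s' hs' x => ?_⟩
  obtain ⟨k, hk⟩ := exists_add_mem_box x
  have h1 := hper s x k
  have h2 := hper s' x k
  dsimp only at h1 h2
  rw [← h1, ← h2]
  set y := x + fun i => (k i : ℝ)
  have hconv : Convex ℝ (Set.Icc (0:ℝ) T ×ˢ Set.Icc (0 : Fin d → ℝ) 1) :=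
    (convex_Icc _ _).prod (convex_Icc _ _)
  have hy := box_subset_Icc d hk
  have h3 := hconv.norm_image_sub_le_of_norm_fderiv_le (𝕜 := ℝ) (f := F) (C := max L 0)
    (fun q _ => hF.differentiable one_ne_zero q) (fun q hq => (hL q hq).trans (le_max_left _ _))
    (Set.mk_mem_prod hs' hy) (Set.mk_mem_prod hs hy)
  refine h3.trans (le_of_eq ?_)
  simp [Prod.norm_def]

lemma abs_le_mul_sq_of_hasDerivAt {φ φ' φ'' : ℝ → ℝ} {M T : ℝ} (h : ∀ τ, HasDerivAt φ (φ' τ) τ)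
    (h' : ∀ τ, HasDerivAt φ' (φ'' τ) τ) (h0 : φ 0 = 0) (h0' : φ' 0 = 0)
    (hM : ∀ τ ∈ Set.Icc 0 T, |φ'' τ| ≤ M) {τ : ℝ} (hτ : τ ∈ Set.Icc 0 T) : |φ τ| ≤ M * τ ^ 2 := by
  have hM0 : 0 ≤ M := (abs_nonneg _).trans (hM τ hτ)
  have h1 : ∀ σ ∈ Set.Icc 0 τ, |φ' σ| ≤ M * τ := by
    intro σ hσ
    have := (convex_Icc 0 τ).norm_image_sub_le_of_norm_hasDerivWithin_le
      (fun x _ => (h' x).hasDerivWithinAt)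
      (fun x hx => hM x ⟨hx.1, hx.2.trans hτ.2⟩) (Set.left_mem_Icc.2 hτ.1) hσ
    rw [h0', sub_zero, sub_zero, Real.norm_eq_abs, Real.norm_of_nonneg hσ.1] at this
    exact this.trans (by gcongr; exact hσ.2)
  have := (convex_Icc 0 τ).norm_image_sub_le_of_norm_hasDerivWithin_le
    (fun x _ => (h x).hasDerivWithinAt) h1 (Set.left_mem_Icc.2 hτ.1) (Set.right_mem_Icc.2 hτ.1)
  rw [h0, sub_zero, sub_zero, Real.norm_eq_abs, Real.norm_of_nonneg hτ.1] at this
  exact this.trans (le_of_eq (by ring))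

lemma exists_forall_abs_le_mul_sq {d : ℕ} {F : ℝ × (ℝ × (Fin d → ℝ)) → ℝ}
    (hF : ContDiff ℝ 2 F) (h0 : ∀ v, F (0, v) = 0)
    (h0' : ∀ v, HasDerivAt (fun τ => F (τ, v)) 0 0)
    (hper : ∀ τ s, IsPeriodic fun x => F (τ, (s, x))) (T : ℝ) :
    ∃ M : ℝ, 0 ≤ M ∧ ∀ τ ∈ Set.Icc (0:ℝ) T, ∀ s ∈ Set.Icc (0:ℝ) T, ∀ x,
      |F (τ, (s, x))| ≤ M * τ ^ 2 := by
  set e : ℝ × (ℝ × (Fin d → ℝ)) := (1, 0) with he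
  have hcurve (v : ℝ × (Fin d → ℝ)) (τ : ℝ) : HasDerivAt (fun τ : ℝ => (τ, v)) e τ :=
    (hasDerivAt_id τ).prodMk (hasDerivAt_const τ v)
  have hF1 : ContDiff ℝ 1 fun q => fderiv ℝ F q e :=
    (hF.fderiv_right (by norm_num)).clm_apply contDiff_const
  have hF2 : Continuous fun q => fderiv ℝ (fun q => fderiv ℝ F q e) q e :=
    ((hF1.continuous_fderiv one_ne_zero)).clm_apply continuous_const
  have hd1 (v : ℝ × (Fin d → ℝ)) (τ : ℝ) :
      HasDerivAt (fun τ => F (τ, v)) (fderiv ℝ F (τ, v) e) τ :=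
    ((hF.differentiable two_ne_zero _).hasFDerivAt).comp_hasDerivAt τ (hcurve v τ)
  have hd2 (v : ℝ × (Fin d → ℝ)) (τ : ℝ) :
      HasDerivAt (fun τ => fderiv ℝ F (τ, v) e)
        (fderiv ℝ (fun q => fderiv ℝ F q e) (τ, v) e) τ :=
    ((hF1.differentiable one_ne_zero _).hasFDerivAt).comp_hasDerivAt τ (hcurve v τ)
  obtain ⟨M, hM⟩ := (isCompact_Icc.prod
    (isCompact_Icc_prod_Icc d T) : IsCompact (Set.Icc (0:ℝ) T ×ˢ _)).exists_bound_of_continuousOn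
    hF2.continuousOn
  refine ⟨max M 0, le_max_right _ _, fun τ hτ s hs x => ?_⟩
  obtain ⟨k, hk⟩ := exists_add_mem_box x
  have h1 := hper τ s x k
  dsimp only at h1
  rw [← h1]
  set y := x + fun i => (k i : ℝ)
  exact abs_le_mul_sq_of_hasDerivAt (hd1 (s, y)) (hd2 (s, y)) (h0 _)
    ((hd1 (s, y) 0).unique (h0' _))
    (fun σ hσ => (hM _ ⟨hσ, hs, box_subset_Icc d hk⟩).trans (le_max_left _ _)) hτ

lemma fderiv_uncurry_left {E F : Type*} [NormedAddCommGroup E] [NormedSpace ℝ E]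
    [NormedAddCommGroup F] [NormedSpace ℝ F] {u : ℝ → E → F}
    (hu : Differentiable ℝ fun q : ℝ × E => u q.1 q.2) (s : ℝ) (x v : E) :
    fderiv ℝ (u s) x v = fderiv ℝ (fun q : ℝ × E => u q.1 q.2) (s, x) (0, v) := by
  have h := (hu (s, x)).hasFDerivAt.comp x ((hasFDerivAt_const s x).prodMk (hasFDerivAt_id x))
  have h2 : HasFDerivAt (u s) _ x := h
  rw [h2.fderiv]
  rfl

lemma exists_transport_error_le {d : ℕ} {b : ℝ → (Fin d → ℝ) → (Fin d → ℝ)}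
    {θ : ℝ → (Fin d → ℝ) → ℝ}
    (hb : ContDiff ℝ (⊤ : ℕ∞) (fun q : ℝ × (Fin d → ℝ) => b q.1 q.2))
    (hθ : ContDiff ℝ (⊤ : ℕ∞) (fun q : ℝ × (Fin d → ℝ) => θ q.1 q.2))
    (hbper : ∀ t, IsPeriodic (b t)) (hθper : ∀ t, IsPeriodic (θ t))
    (heq : ∀ t x, deriv (fun s => θ s x) t +
      ∑ i, b t x i * fderiv ℝ (θ t) x (Pi.single i 1) = 0) (T : ℝ) :
    ∃ E : ℝ, 0 ≤ E ∧ ∀ ε ∈ Set.Icc (0:ℝ) T, ∀ s ∈ Set.Icc (0:ℝ) T, ∀ x,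
      |θ (s - ε) (x - ε • b s x) - θ s x| ≤ E * ε ^ 2 := by
  refine exists_forall_abs_le_mul_sq
    (F := fun q : ℝ × (ℝ × (Fin d → ℝ)) =>
      θ (q.2.1 - q.1) (q.2.2 - q.1 • b q.2.1 q.2.2) - θ q.2.1 q.2.2) ?_ ?_ ?_ ?_ T
  · have hb2 : ContDiff ℝ 2 (fun q : ℝ × (Fin d → ℝ) => b q.1 q.2) := hb.of_le (by norm_cast)
    have hθ2 : ContDiff ℝ 2 (fun q : ℝ × (Fin d → ℝ) => θ q.1 q.2) := hθ.of_le (by norm_cast)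
    have h1 : ContDiff ℝ 2 fun q : ℝ × (ℝ × (Fin d → ℝ)) => b q.2.1 q.2.2 :=
      hb2.comp contDiff_snd
    have h2 : ContDiff ℝ 2 fun q : ℝ × (ℝ × (Fin d → ℝ)) =>
        (q.2.1 - q.1, q.2.2 - q.1 • b q.2.1 q.2.2) := by fun_prop
    exact (hθ2.comp h2).sub (hθ2.comp contDiff_snd)
  · rintro ⟨s, x⟩
    simp
  · rintro ⟨s, x⟩
    have hd : Differentiable ℝ fun q : ℝ × (Fin d → ℝ) => θ q.1 q.2 := hθ.differentiable (by simp)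
    set D := fderiv ℝ (fun q : ℝ × (Fin d → ℝ) => θ q.1 q.2) (s, x) with hD
    have hfd : HasFDerivAt (fun q : ℝ × (Fin d → ℝ) => θ q.1 q.2) D (s, x) := (hd _).hasFDerivAt
    have hcurve : HasDerivAt (fun τ : ℝ => (s - τ, x - τ • b s x)) (-1, -(b s x)) 0 := by
      refine HasDerivAt.prodMk ?_ ?_
      · simpa using (hasDerivAt_id (0:ℝ)).const_sub s
      · simpa using ((hasDerivAt_id (0:ℝ)).smul_const (b s x)).const_sub x
    have h1 : HasDerivAt (fun τ : ℝ => θ (s - τ) (x - τ • b s x)) (D (-1, -(b s x))) 0 :=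
      HasFDerivAt.comp_hasDerivAt (l := fun q : ℝ × (Fin d → ℝ) => θ q.1 q.2) 0
        (by simpa only [sub_zero, zero_smul] using hfd) hcurve
    have h2 : deriv (fun s => θ s x) s = D (1, 0) := by
      have h3 : HasDerivAt (fun τ : ℝ => (τ, x)) ((1:ℝ), (0 : Fin d → ℝ)) s :=
        (hasDerivAt_id s).prodMk (hasDerivAt_const s x)
      exact (HasFDerivAt.comp_hasDerivAt (l := fun q : ℝ × (Fin d → ℝ) => θ q.1 q.2) s
        hfd h3).deriv
    have h4 : ∑ i, b s x i * fderiv ℝ (θ s) x (Pi.single i 1) = D (0, b s x) := by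
      rw [hD, ← fderiv_uncurry_left hd]
      conv_rhs => rw [pi_eq_sum_univ' (b s x)]
      rw [map_sum]
      refine Finset.sum_congr rfl fun i _ => ?_
      rw [map_smul, smul_eq_mul]
    have h5 : D (-1, -(b s x)) = 0 := by
      have h6 : ((-1 : ℝ), -(b s x)) = -(((1:ℝ), (0 : Fin d → ℝ)) + (0, b s x)) := by simp
      rw [h6, map_neg, map_add, ← h2, ← h4, heq, neg_zero]
    rw [h5] at h1
    simpa using h1.sub_const (θ s x)
  · intro τ s x k
    dsimp only
    rw [hbper, hθper, add_sub_right_comm, hθper]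

/-- The matrix of partial derivatives of a vector field. -/
def jacobian {d : ℕ} (u : (Fin d → ℝ) → (Fin d → ℝ)) (x : Fin d → ℝ) :
    Matrix (Fin d) (Fin d) ℝ :=
  Matrix.of fun i j => fderiv ℝ u x (Pi.single j 1) i

lemma jacobian_apply {d : ℕ} (u : (Fin d → ℝ) → (Fin d → ℝ)) (x : Fin d → ℝ) (i j : Fin d) :
    jacobian u x i j = fderiv ℝ u x (Pi.single j 1) i := rfl

lemma det_id_sub_smul_fderiv {d : ℕ} (u : (Fin d → ℝ) → (Fin d → ℝ)) (x : Fin d → ℝ) (ε : ℝ) :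
    (ContinuousLinearMap.id ℝ (Fin d → ℝ) - ε • fderiv ℝ u x).det =
      (1 + (-ε) • jacobian u x).det := by
  rw [ContinuousLinearMap.det, ← LinearMap.det_toMatrix']
  congr 1
  ext i j
  simp [LinearMap.toMatrix'_apply, jacobian_apply, Matrix.one_apply, Pi.single_apply,
    sub_eq_add_neg]

lemma hasDerivAt_det_one_sub_smul {d : ℕ} {M : Matrix (Fin d) (Fin d) ℝ} (hM : M.trace = 0) :
    HasDerivAt (fun τ : ℝ => (1 + (-τ) • M).det - 1) 0 0 := by
  set P := (Matrix.det (1 + (Polynomial.X : Polynomial ℝ) • M.map Polynomial.C)).divX.divX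
  have h1 : (fun τ : ℝ => (1 + (-τ) • M).det - 1) = fun τ : ℝ => P.eval (-τ) * τ ^ 2 := by
    funext τ
    rw [Matrix.det_one_add_smul, hM]
    ring
  have h2 : DifferentiableAt ℝ (fun τ : ℝ => P.eval (-τ)) 0 :=
    (P.differentiable _).comp 0 differentiableAt_id.neg
  rw [h1]
  have h3 := h2.hasDerivAt.mul (hasDerivAt_pow 2 (0:ℝ))
  simp only [neg_zero, ne_eq, OfNat.ofNat_ne_zero, not_false_eq_true, zero_pow, mul_zero,
    Nat.cast_ofNat, Nat.add_one_sub_one, pow_one, add_zero] at h3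
  exact h3

lemma differentiable_of_uncurry_left {d : ℕ} {b : ℝ → (Fin d → ℝ) → (Fin d → ℝ)}
    (hb : ContDiff ℝ (⊤ : ℕ∞) (fun q : ℝ × (Fin d → ℝ) => b q.1 q.2)) (s : ℝ) :
    Differentiable ℝ (b s) := by
  have h : Differentiable ℝ fun q : ℝ × (Fin d → ℝ) => b q.1 q.2 := hb.differentiable (by simp)
  intro x
  exact (h (s, x)).comp x (by fun_prop : DifferentiableAt ℝ (fun x => (s, x)) x)

lemma contDiff_fderiv_uncurry {d : ℕ} {b : ℝ → (Fin d → ℝ) → (Fin d → ℝ)}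
    (hb : ContDiff ℝ (⊤ : ℕ∞) (fun q : ℝ × (Fin d → ℝ) => b q.1 q.2)) :
    ContDiff ℝ 2 fun q : ℝ × (Fin d → ℝ) => fderiv ℝ (b q.1) q.2 := by
  refine ContDiff.fderiv (f := fun q : ℝ × (Fin d → ℝ) => b q.1) (m := (⊤ : ℕ∞)) ?_
    contDiff_snd (by norm_cast)
  exact hb.comp (g := fun q : ℝ × (Fin d → ℝ) => b q.1 q.2)
    (f := fun q : (ℝ × (Fin d → ℝ)) × (Fin d → ℝ) => (q.1.1, q.2)) (by fun_prop)

lemma exists_det_error_le {d : ℕ} {b : ℝ → (Fin d → ℝ) → (Fin d → ℝ)}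
    (hb : ContDiff ℝ (⊤ : ℕ∞) (fun q : ℝ × (Fin d → ℝ) => b q.1 q.2))
    (hbper : ∀ t, IsPeriodic (b t))
    (hdiv : ∀ t x, ∑ i, fderiv ℝ (fun y => b t y i) x (Pi.single i 1) = 0) (T : ℝ) :
    ∃ E : ℝ, 0 ≤ E ∧ ∀ ε ∈ Set.Icc (0:ℝ) T, ∀ s ∈ Set.Icc (0:ℝ) T, ∀ x,
      |(ContinuousLinearMap.id ℝ (Fin d → ℝ) - ε • fderiv ℝ (b s) x).det - 1| ≤ E * ε ^ 2 := by
  have htr (s : ℝ) (x : Fin d → ℝ) : (jacobian (b s) x).trace = 0 := by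
    rw [← hdiv s x]
    refine Finset.sum_congr rfl fun i _ => ?_
    rw [Matrix.diag_apply, jacobian_apply, fderiv_apply (differentiable_of_uncurry_left hb s x)]
    rfl
  simp only [det_id_sub_smul_fderiv]
  refine exists_forall_abs_le_mul_sq
    (F := fun q : ℝ × (ℝ × (Fin d → ℝ)) =>
      (1 + (-q.1) • jacobian (b q.2.1) q.2.2).det - 1) ?_ ?_ ?_ ?_ T
  · have h1 := contDiff_fderiv_uncurry hb
    have h2 (i j : Fin d) : ContDiff ℝ 2 fun q : ℝ × (ℝ × (Fin d → ℝ)) =>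
        (1 + (-q.1) • jacobian (b q.2.1) q.2.2) i j := by
      simp only [Matrix.add_apply, Matrix.smul_apply, jacobian_apply, smul_eq_mul]
      refine contDiff_const.add (contDiff_fst.neg.mul ?_)
      exact contDiff_pi.1 ((h1.comp contDiff_snd).clm_apply contDiff_const) i
    simp only [Matrix.det_apply]
    refine ContDiff.sub (ContDiff.sum fun σ _ => ?_) contDiff_const
    exact (contDiff_prod fun i _ => h2 _ _).const_smul _
  · rintro ⟨s, x⟩
    simp
  · rintro ⟨s, x⟩
    exact hasDerivAt_det_one_sub_smul (htr s x)
  · intro τ s x k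
    have := (hbper s).fderiv x k
    simp only [jacobian]
    rw [this]

instance isProbabilityMeasure_restrict_box (d : ℕ) :
    IsProbabilityMeasure (volume.restrict (box d)) :=
  ⟨by rw [Measure.restrict_apply_univ, volume_box]⟩

/-- The `L^p` norm of the spatial gradient of `b` at time `s`. -/
def gradNorm {d : ℕ} (p : ℝ) (b : ℝ → (Fin d → ℝ) → (Fin d → ℝ)) (s : ℝ) : ℝ :=
  (eLpNorm (fun x => ‖fderiv ℝ (b s) x‖) (ENNReal.ofReal p) (volume.restrict (box d))).toReal

lemma gradNorm_nonneg {d : ℕ} (p : ℝ) (b : ℝ → (Fin d → ℝ) → (Fin d → ℝ)) (s : ℝ) :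
    0 ≤ gradNorm p b s := ENNReal.toReal_nonneg

lemma continuous_fderiv_uncurry {d : ℕ} {b : ℝ → (Fin d → ℝ) → (Fin d → ℝ)}
    (hb : ContDiff ℝ (⊤ : ℕ∞) (fun q : ℝ × (Fin d → ℝ) => b q.1 q.2)) (s : ℝ) :
    Continuous fun x => ‖fderiv ℝ (b s) x‖ :=
  ((contDiff_fderiv_uncurry hb).continuous.comp
    (by fun_prop : Continuous fun x : Fin d → ℝ => (s, x))).norm

lemma ofReal_gradNorm {d : ℕ} (p : ℝ) {b : ℝ → (Fin d → ℝ) → (Fin d → ℝ)} {L : ℝ} {s : ℝ}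
    (hL : ∀ x, ‖fderiv ℝ (b s) x‖ ≤ L) : ENNReal.ofReal (gradNorm p b s) =
      eLpNorm (fun x => ‖fderiv ℝ (b s) x‖) (ENNReal.ofReal p) (volume.restrict (box d)) := by
  refine ENNReal.ofReal_toReal (ne_top_of_le_ne_top ?_ (eLpNorm_le_of_ae_bound (C := L)
    (ae_of_all _ fun x => by rw [norm_norm]; exact hL x)))
  simp

lemma gradNorm_le_add {d : ℕ} {p : ℝ} (hp : 1 < p) {b : ℝ → (Fin d → ℝ) → (Fin d → ℝ)}
    (hb : ContDiff ℝ (⊤ : ℕ∞) (fun q : ℝ × (Fin d → ℝ) => b q.1 q.2)) {L c : ℝ} {s s' : ℝ}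
    (hL : ∀ x, ‖fderiv ℝ (b s) x‖ ≤ L) (hL' : ∀ x, ‖fderiv ℝ (b s') x‖ ≤ L) (hc : 0 ≤ c)
    (h : ∀ x, ‖fderiv ℝ (b s) x - fderiv ℝ (b s') x‖ ≤ c) :
    gradNorm p b s ≤ gradNorm p b s' + c := by
  have hp0 : ENNReal.ofReal p ≠ 0 := by
    rw [Ne, ENNReal.ofReal_eq_zero, not_le]; linarith
  have hg := gradNorm_nonneg p b s'
  rw [← ENNReal.ofReal_le_ofReal_iff (by positivity), ENNReal.ofReal_add hg hc,
    ofReal_gradNorm p hL, ofReal_gradNorm p hL']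
  calc _ ≤ eLpNorm ((fun x => ‖fderiv ℝ (b s') x‖) + fun _ => c) (ENNReal.ofReal p)
        (volume.restrict (box d)) := by
        refine eLpNorm_mono_real fun x => ?_
        rw [norm_norm, Pi.add_apply]
        have := norm_sub_norm_le (fderiv ℝ (b s) x) (fderiv ℝ (b s') x)
        linarith [h x]
    _ ≤ _ := eLpNorm_add_le (continuous_fderiv_uncurry hb s').aestronglyMeasurable
        aestronglyMeasurable_const (by rw [← ENNReal.ofReal_one]; exact ENNReal.ofReal_le_ofReal hp.le)
    _ = _ := by
        rw [eLpNorm_const _ hp0 (IsProbabilityMeasure.ne_zero _), measure_univ, ENNReal.one_rpow,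
          mul_one, Real.enorm_of_nonneg hc]

lemma exists_mul_gradNorm_le {d : ℕ} {p : ℝ} (hp : 1 < p) {b : ℝ → (Fin d → ℝ) → (Fin d → ℝ)}
    (hb : ContDiff ℝ (⊤ : ℕ∞) (fun q : ℝ × (Fin d → ℝ) => b q.1 q.2))
    (hbper : ∀ t, IsPeriodic (b t)) (T : ℝ) :
    ∃ L : ℝ, 0 ≤ L ∧ (∀ s ∈ Set.Icc 0 T, ∀ x, ‖fderiv ℝ (b s) x‖ ≤ L) ∧
      ContinuousOn (gradNorm p b) (Set.Icc 0 T) ∧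
      ∀ r s : ℝ, 0 ≤ r → r ≤ s → s ≤ T →
        (s - r) * gradNorm p b s ≤ (∫ u in r..s, gradNorm p b u) + L * (s - r) ^ 2 := by
  have hC := contDiff_fderiv_uncurry hb
  have hper (s : ℝ) : IsPeriodic fun x => fderiv ℝ (b s) x := (hbper s).fderiv
  obtain ⟨L₁, hL₁, h₁⟩ := exists_forall_norm_le_of_periodic hC.continuous hper T
  obtain ⟨L₂, hL₂, h₂⟩ := exists_forall_norm_sub_le_of_periodic (hC.of_le (by norm_num)) hper T
  have hlip : ∀ s ∈ Set.Icc (0:ℝ) T, ∀ s' ∈ Set.Icc (0:ℝ) T,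
      gradNorm p b s ≤ gradNorm p b s' + L₂ * |s - s'| := fun s hs s' hs' =>
    gradNorm_le_add hp hb (h₁ s hs) (h₁ s' hs') (by positivity) (h₂ s hs s' hs')
  have hcont : ContinuousOn (gradNorm p b) (Set.Icc 0 T) := by
    refine (LipschitzOnWith.of_dist_le_mul (K := L₂.toNNReal) fun s hs s' hs' => ?_).continuousOn
    rw [Real.dist_eq, Real.dist_eq, Real.coe_toNNReal _ hL₂, abs_sub_le_iff]
    have h3 := hlip s hs s' hs'
    have h4 := hlip s' hs' s hs
    rw [abs_sub_comm] at h4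
    constructor <;> linarith
  refine ⟨max L₁ L₂, le_max_of_le_left hL₁, fun s hs x => (h₁ s hs x).trans (le_max_left _ _),
    hcont, fun r s hr hrs hs => ?_⟩
  have hint : IntervalIntegrable (gradNorm p b) volume r s := by
    refine (hcont.mono ?_).intervalIntegrable
    rw [Set.uIcc_of_le hrs]
    exact Set.Icc_subset_Icc hr hs
  have hle : ∫ _u in r..s, (gradNorm p b s - max L₁ L₂ * (s - r)) ≤ ∫ u in r..s, gradNorm p b u := by
    refine intervalIntegral.integral_mono_on hrs (by simp) hint fun u hu => ?_
    have h3 := hlip s ⟨hr.trans hrs, hs⟩ u ⟨hr.trans hu.1, hu.2.trans hs⟩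
    have h4 : L₂ * |s - u| ≤ max L₁ L₂ * (s - r) := by
      rw [abs_of_nonneg (by linarith [hu.2])]
      exact mul_le_mul (le_max_right _ _) (by linarith [hu.1]) (by linarith [hu.2])
        (le_max_of_le_left hL₁)
    linarith
  rw [intervalIntegral.integral_const, smul_eq_mul] at hle
  linarith

/-- A map of the torus (lifted to `ℝ^d`) with compression constant `J`, which is Lipschitz up to
the weight `exp (g x + g y)`, where the `L^p` norm of `g` is at most `M`. -/
structure IsWeightedLipschitz {d : ℕ} (p J M : ℝ) (Y : (Fin d → ℝ) → (Fin d → ℝ))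
    (g : (Fin d → ℝ) → ℝ) : Prop where
  measurable : Measurable Y
  map_add_int : ∀ x (k : Fin d → ℤ), Y (x + fun i => (k i : ℝ)) = Y x + fun i => (k i : ℝ)
  measurable_weight : Measurable g
  weight_nonneg : ∀ x, 0 ≤ g x
  weight_periodic : IsPeriodic g
  norm_sub_le : ∀ x y, ‖Y x - Y y‖ ≤ ‖x - y‖ * Real.exp (g x + g y)
  lintegral_comp_le : ∀ F : (Fin d → ℝ) → ℝ≥0∞, IsPeriodic F →
    ∫⁻ x in box d, F (Y x) ≤ ENNReal.ofReal J * ∫⁻ x in box d, F x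
  eLpNorm_le : eLpNorm g (ENNReal.ofReal p) (volume.restrict (box d)) ≤ ENNReal.ofReal M

namespace IsWeightedLipschitz

variable {d : ℕ} {p J M J' M' : ℝ} {Y S : (Fin d → ℝ) → (Fin d → ℝ)} {g g' : (Fin d → ℝ) → ℝ}

lemma id (p : ℝ) : IsWeightedLipschitz (d := d) p 1 0 (fun x => x) 0 where
  measurable := measurable_id
  map_add_int _ _ := rfl
  measurable_weight := measurable_const
  weight_nonneg _ := le_rfl
  weight_periodic _ _ := rfl
  norm_sub_le x y := by simp
  lintegral_comp_le F _ := by simp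
  eLpNorm_le := by simp

lemma eLpNorm_comp_le (hp : 1 < p) (hJ : 1 ≤ J) (hS : IsWeightedLipschitz p J M S g)
    {f : (Fin d → ℝ) → ℝ} (hf : IsPeriodic f) :
    eLpNorm (fun x => f (S x)) (ENNReal.ofReal p) (volume.restrict (box d)) ≤
      ENNReal.ofReal J * eLpNorm f (ENNReal.ofReal p) (volume.restrict (box d)) := by
  have hp0 : 0 < p := by linarith
  have hne : ENNReal.ofReal p ≠ 0 := by rwa [Ne, ENNReal.ofReal_eq_zero, not_le]
  rw [eLpNorm_eq_lintegral_rpow_enorm_toReal hne ENNReal.ofReal_ne_top,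
    eLpNorm_eq_lintegral_rpow_enorm_toReal hne ENNReal.ofReal_ne_top, ENNReal.toReal_ofReal hp0.le]
  have hinv : 0 ≤ 1 / p := by positivity
  calc _ ≤ (ENNReal.ofReal J * ∫⁻ x in box d, ‖f x‖ₑ ^ p) ^ (1 / p) :=
        ENNReal.rpow_le_rpow (hS.lintegral_comp_le (fun x => ‖f x‖ₑ ^ p)
          fun x k => by simp only [hf x k]) hinv
    _ = ENNReal.ofReal J ^ (1 / p) * (∫⁻ x in box d, ‖f x‖ₑ ^ p) ^ (1 / p) :=
        ENNReal.mul_rpow_of_nonneg _ _ hinv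
    _ ≤ _ := by
        gcongr
        conv_rhs => rw [← ENNReal.rpow_one (ENNReal.ofReal J)]
        refine ENNReal.rpow_le_rpow_of_exponent_le (by rwa [ENNReal.one_le_ofReal]) ?_
        rw [div_le_one hp0]
        exact hp.le

lemma comp (hp : 1 < p) (hJ' : 1 ≤ J') (hM : 0 ≤ M) (hM' : 0 ≤ M')
    (hY : IsWeightedLipschitz p J M Y g) (hS : IsWeightedLipschitz p J' M' S g') :
    IsWeightedLipschitz p (J' * J) (J' * M + M') (fun x => Y (S x))
      ((fun x => g (S x)) + g') where
  measurable := hY.measurable.comp hS.measurable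
  map_add_int x k := by rw [hS.map_add_int, hY.map_add_int]
  measurable_weight := (hY.measurable_weight.comp hS.measurable).add hS.measurable_weight
  weight_nonneg x := add_nonneg (hY.weight_nonneg _) (hS.weight_nonneg x)
  weight_periodic x k := by
    simp only [Pi.add_apply]
    rw [hS.map_add_int, hY.weight_periodic, hS.weight_periodic]
  norm_sub_le x y := by
    calc _ ≤ ‖S x - S y‖ * Real.exp (g (S x) + g (S y)) := hY.norm_sub_le _ _
      _ ≤ ‖x - y‖ * Real.exp (g' x + g' y) * Real.exp (g (S x) + g (S y)) := by
          gcongr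
          exact hS.norm_sub_le x y
      _ = _ := by
          rw [mul_assoc, ← Real.exp_add]
          simp only [Pi.add_apply]
          ring_nf
  lintegral_comp_le F hF := by
    have hFY : IsPeriodic fun x => F (Y x) := fun x k => by
      simp only [hY.map_add_int, hF (Y x) k]
    refine (hS.lintegral_comp_le _ hFY).trans ?_
    rw [ENNReal.ofReal_mul (by linarith), mul_assoc]
    gcongr
    exact hY.lintegral_comp_le F hF
  eLpNorm_le := by
    refine (eLpNorm_add_le (hY.measurable_weight.comp hS.measurable).aestronglyMeasurable
      hS.measurable_weight.aestronglyMeasurable ?_).trans ?_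
    · rw [← ENNReal.ofReal_one]
      exact ENNReal.ofReal_le_ofReal hp.le
    · rw [ENNReal.ofReal_add (by positivity) hM', ENNReal.ofReal_mul (by linarith)]
      refine add_le_add ((hS.eLpNorm_comp_le hp hJ' hY.weight_periodic).trans ?_) hS.eLpNorm_le
      gcongr
      exact hY.eLpNorm_le

lemma mono (hY : IsWeightedLipschitz p J M Y g) (hJ : J ≤ J') (hM : M ≤ M') :
    IsWeightedLipschitz p J' M' Y g :=
  { hY with
    lintegral_comp_le := fun F hF => (hY.lintegral_comp_le F hF).trans (by gcongr)
    eLpNorm_le := hY.eLpNorm_le.trans (by gcongr) }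

/-- An explicit Euler step along a Lipschitz periodic vector field which is almost
divergence-free. -/
lemma sub_smul {u : (Fin d → ℝ) → (Fin d → ℝ)} {G : (Fin d → ℝ) → ℝ} {ε L δ : ℝ}
    (hu : Differentiable ℝ u) (hper : IsPeriodic u) (hL : ∀ x, ‖fderiv ℝ u x‖ ≤ L)
    (hε : 0 ≤ ε) (hεL : ε * L < 1) (hδ : δ ≤ 1 / 2)
    (hdet : ∀ x, |(ContinuousLinearMap.id ℝ (Fin d → ℝ) - ε • fderiv ℝ u x).det - 1| ≤ δ)
    (hG : Measurable G) (hG0 : ∀ x, 0 ≤ G x) (hGper : IsPeriodic G)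
    (hGu : ∀ x y, ‖u x - u y‖ ≤ ‖x - y‖ * (G x + G y))
    (hM : eLpNorm G (ENNReal.ofReal p) (volume.restrict (box d)) ≤ ENNReal.ofReal M) :
    IsWeightedLipschitz p (1 + 2 * δ) (ε * M) (fun x => x - ε • u x) (ε • G) where
  measurable := measurable_id.sub (hu.continuous.measurable.const_smul ε)
  map_add_int x k := by rw [hper, add_sub_right_comm]
  measurable_weight := hG.const_smul ε
  weight_nonneg x := mul_nonneg hε (hG0 x)
  weight_periodic x k := by simp only [Pi.smul_apply, hGper x k]
  norm_sub_le x y := by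
    have h1 : x - ε • u x - (y - ε • u y) = (x - y) - ε • (u x - u y) := by
      rw [smul_sub]; abel
    calc ‖x - ε • u x - (y - ε • u y)‖ ≤ ‖x - y‖ + ‖ε • (u x - u y)‖ := by
          rw [h1]; exact _root_.norm_sub_le _ _
      _ ≤ ‖x - y‖ + ε * (‖x - y‖ * (G x + G y)) := by
          rw [norm_smul, Real.norm_of_nonneg hε]
          gcongr
          exact hGu x y
      _ = ‖x - y‖ * ((ε * G x + ε * G y) + 1) := by ring
      _ ≤ _ := by
          gcongr
          exact Real.add_one_le_exp _
  lintegral_comp_le F hF := by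
    have hδ0 : 0 ≤ δ := (abs_nonneg _).trans (hdet 0)
    refine setLIntegral_box_comp_le hF (S := fun x => x - ε • u x)
      (S' := fun x => ContinuousLinearMap.id ℝ (Fin d → ℝ) - ε • fderiv ℝ u x)
      (fun x => (hasFDerivAt_id x).sub ((hu x).hasFDerivAt.const_smul ε)) ?_
      (fun x k => by rw [hper, add_sub_right_comm]) ?_ (by linarith)
    · intro x y hxy
      have h1 : x - y = ε • (u x - u y) := by
        have hxy' : x - ε • u x = y - ε • u y := hxy
        rw [smul_sub, sub_eq_sub_iff_add_eq_add, add_comm x, add_comm _ y]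
        rw [sub_eq_sub_iff_add_eq_add] at hxy'
        rw [← hxy', add_comm]
      have h2 : ‖u x - u y‖ ≤ L * ‖x - y‖ :=
        convex_univ.norm_image_sub_le_of_norm_fderiv_le (𝕜 := ℝ) (fun z _ => hu z)
          (fun z _ => hL z) (Set.mem_univ y) (Set.mem_univ x)
      have h3 : ‖x - y‖ ≤ ε * L * ‖x - y‖ := by
        conv_lhs => rw [h1, norm_smul, Real.norm_of_nonneg hε]
        rw [mul_assoc]
        gcongr
      have h4 : ‖x - y‖ = 0 := by
        by_contra h
        have := lt_of_le_of_ne (norm_nonneg (x - y)) (Ne.symm h)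
        nlinarith
      exact sub_eq_zero.1 (norm_eq_zero.1 h4)
    · intro x
      have h1 := (abs_le.1 (hdet x)).1
      have h2 := le_abs_self (ContinuousLinearMap.id ℝ (Fin d → ℝ) - ε • fderiv ℝ u x).det
      calc (1:ℝ) ≤ (1 + 2 * δ) * (1 - δ) := by nlinarith
        _ ≤ _ := by
          gcongr
          linarith
  eLpNorm_le := by
    rw [eLpNorm_const_smul, ENNReal.ofReal_mul hε, Real.enorm_of_nonneg hε]
    gcongr

end IsWeightedLipschitz

/-- Discretising the backward flow by `n` explicit Euler steps writes `θ t`, up to `O(1/n)`, as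
the composition of `θ 0` with a map which is Lipschitz up to a weight controlled in `L^p` by the
time integral of `‖∇b‖_{L^p}`. -/
lemma exists_euler_approx {d : ℕ} {p : ℝ} (hp : 1 < p) {A : ℝ} (hA : 0 ≤ A)
    (hAw : ∀ u : (Fin d → ℝ) → (Fin d → ℝ), ContDiff ℝ 1 u → IsPeriodic u →
      ∀ L, (∀ x, ‖fderiv ℝ u x‖ ≤ L) → ∃ G : (Fin d → ℝ) → ℝ, Measurable G ∧ (∀ x, 0 ≤ G x) ∧
        IsPeriodic G ∧ (∀ x y, ‖u x - u y‖ ≤ ‖x - y‖ * (G x + G y)) ∧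
        eLpNorm G (ENNReal.ofReal p) (volume.restrict (box d)) ≤ ENNReal.ofReal A *
          eLpNorm (fun x => ‖fderiv ℝ u x‖) (ENNReal.ofReal p) (volume.restrict (box d)))
    {b : ℝ → (Fin d → ℝ) → (Fin d → ℝ)} {θ : ℝ → (Fin d → ℝ) → ℝ}
    (hb : ContDiff ℝ (⊤ : ℕ∞) (fun q : ℝ × (Fin d → ℝ) => b q.1 q.2))
    (hbper : ∀ t, IsPeriodic (b t)) {T E D L : ℝ} (hL0 : 0 ≤ L)
    (hE : ∀ ε ∈ Set.Icc (0:ℝ) T, ∀ s ∈ Set.Icc (0:ℝ) T, ∀ x,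
      |θ (s - ε) (x - ε • b s x) - θ s x| ≤ E * ε ^ 2)
    (hD0 : 0 ≤ D)
    (hD : ∀ ε ∈ Set.Icc (0:ℝ) T, ∀ s ∈ Set.Icc (0:ℝ) T, ∀ x,
      |(ContinuousLinearMap.id ℝ (Fin d → ℝ) - ε • fderiv ℝ (b s) x).det - 1| ≤ D * ε ^ 2)
    (hL : ∀ s ∈ Set.Icc 0 T, ∀ x, ‖fderiv ℝ (b s) x‖ ≤ L)
    (hcont : ContinuousOn (gradNorm p b) (Set.Icc 0 T))
    (hint : ∀ r s : ℝ, 0 ≤ r → r ≤ s → s ≤ T →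
      (s - r) * gradNorm p b s ≤ (∫ u in r..s, gradNorm p b u) + L * (s - r) ^ 2)
    {ε : ℝ} (hε : 0 ≤ ε) (hεL : ε * L < 1) (hεD : D * ε ^ 2 ≤ 1 / 2) (k : ℕ) (hk : k * ε ≤ T) :
    ∃ Y g, IsWeightedLipschitz p ((1 + 2 * (D * ε ^ 2)) ^ k)
      ((1 + 2 * (D * ε ^ 2)) ^ k * (A * ((∫ u in (0:ℝ)..(k * ε), gradNorm p b u) + k * (L * ε ^ 2))))
      Y g ∧ ∀ x, |θ (k * ε) x - θ 0 (Y x)| ≤ k * (E * ε ^ 2) := by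
  induction k with
  | zero => exact ⟨_, _, by simpa using IsWeightedLipschitz.id p, by simp⟩
  | succ k ih =>
    have hkε : 0 ≤ k * ε := by positivity
    have hsucc : ((k + 1 : ℕ) : ℝ) * ε = k * ε + ε := by push_cast; ring
    rw [hsucc] at hk ⊢
    obtain ⟨Y, g, hY, hθY⟩ := ih (by linarith)
    have hs : k * ε + ε ∈ Set.Icc (0:ℝ) T := ⟨by positivity, hk⟩
    have hεT : ε ∈ Set.Icc (0:ℝ) T := ⟨hε, by linarith⟩
    obtain ⟨G, hGm, hG0, hGper, hGb, hGp⟩ := hAw (b (k * ε + ε))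
      ((hb.comp (contDiff_const.prodMk contDiff_id)).of_le (by norm_cast)) (hbper _) L (hL _ hs)
    rw [← ofReal_gradNorm p (hL _ hs), ← ENNReal.ofReal_mul hA] at hGp
    have hS := IsWeightedLipschitz.sub_smul (differentiable_of_uncurry_left hb _) (hbper _)
      (hL _ hs) hε hεL hεD (hD ε hεT _ hs) hGm hG0 hGper hGb hGp
    have hDε : 0 ≤ D * ε ^ 2 := by positivity
    have hJ : 1 ≤ 1 + 2 * (D * ε ^ 2) := by linarith
    have hI : 0 ≤ ∫ u in (0:ℝ)..(k * ε), gradNorm p b u :=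
      intervalIntegral.integral_nonneg hkε fun u _ => gradNorm_nonneg p b u
    have hii {r s : ℝ} (hr : 0 ≤ r) (hrs : r ≤ s) (hsT : s ≤ T) :
        IntervalIntegrable (gradNorm p b) volume r s := by
      refine (hcont.mono ?_).intervalIntegrable
      rw [Set.uIcc_of_le hrs]
      exact Set.Icc_subset_Icc hr hsT
    have hadd := intervalIntegral.integral_add_adjacent_intervals
      (hii le_rfl hkε (by linarith)) (hii hkε (by linarith) hk)
    have hstep := hint (k * ε) (k * ε + ε) hkε (by linarith) hk
    rw [add_sub_cancel_left] at hstep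
    refine ⟨_, _, (IsWeightedLipschitz.comp hp hJ (by positivity)
      (mul_nonneg hε (mul_nonneg hA (gradNorm_nonneg p b _))) hY hS).mono (pow_succ' _ _).ge ?_,
      fun x => ?_⟩
    · rw [← hadd, ← mul_assoc, ← pow_succ']
      have ha := gradNorm_nonneg p b (k * ε + ε)
      generalize gradNorm p b (k * ε + ε) = a at *
      have hJk : 1 ≤ (1 + 2 * (D * ε ^ 2)) ^ (k + 1) := one_le_pow₀ hJ
      generalize (1 + 2 * (D * ε ^ 2)) ^ (k + 1) = J at *
      have h1 : ε * (A * a) ≤ A * ((∫ u in (k * ε)..(k * ε + ε), gradNorm p b u) + L * ε ^ 2) := by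
        rw [mul_left_comm]
        gcongr
      have h2 := le_mul_of_one_le_left (mul_nonneg hA ((mul_nonneg hε ha).trans hstep)) hJk
      push_cast
      nlinarith
    · have h1 := hE ε hεT _ hs x
      rw [add_sub_cancel_right, abs_sub_comm] at h1
      have h2 := abs_sub_le (θ (k * ε + ε) x) (θ (k * ε) (x - ε • b (k * ε + ε) x))
        (θ 0 (Y (x - ε • b (k * ε + ε) x)))
      have h3 := hθY (x - ε • b (k * ε + ε) x)
      push_cast
      linarith

lemma IsPeriodic.abs_le_eLpNorm_top {d : ℕ} {f : (Fin d → ℝ) → ℝ} (hf : Continuous f)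
    (hper : IsPeriodic f) (x : Fin d → ℝ) :
    |f x| ≤ (eLpNorm f ∞ (volume.restrict (box d))).toReal := by
  obtain ⟨L, -, hL⟩ := exists_forall_norm_le_of_periodic (F := fun q : ℝ × (Fin d → ℝ) => f q.2)
    (hf.comp continuous_snd) (fun _ => hper) 0
  have htop : eLpNorm f ∞ (volume.restrict (box d)) ≠ ⊤ :=
    ne_top_of_le_ne_top (by simp)
      (eLpNorm_le_of_ae_bound (C := L) (ae_of_all _ fun x => hL 0 (by simp) x))
  set m := (eLpNorm f ∞ (volume.restrict (box d))).toReal with hm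
  have hae : ∀ᵐ y ∂volume.restrict (box d), |f y| ≤ m := by
    rw [eLpNorm_exponent_top] at htop hm
    filter_upwards [ae_le_eLpNormEssSup (f := f) (μ := volume.restrict (box d))] with y hy
    rw [← Real.norm_eq_abs, ← toReal_enorm, hm]
    exact ENNReal.toReal_mono htop hy
  by_contra! hx
  set U := {y | m < |f y|} with hU
  have hUo : IsOpen U := isOpen_lt continuous_const hf.abs
  have hUper : IsPeriodic (U.indicator (1 : (Fin d → ℝ) → ℝ≥0∞)) := fun y k => by
    simp only [Set.indicator_apply, hU, Set.mem_ofPred_eq, hper y k, Pi.one_apply]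
  have hSo : IsOpen (U ∩ Metric.ball x (1 / 2)) := hUo.inter Metric.isOpen_ball
  have hle : volume (U ∩ Metric.ball x (1 / 2)) ≤ 0 :=
    calc volume (U ∩ Metric.ball x (1 / 2))
        = ∫⁻ y in U ∩ Metric.ball x (1 / 2), U.indicator 1 y := by
          rw [setLIntegral_congr_fun hSo.measurableSet (g := fun _ => 1)
            fun y hy => Set.indicator_of_mem hy.1 _, setLIntegral_one]
      _ ≤ ∫⁻ y in box d, U.indicator 1 y := by
          refine setLIntegral_le_setLIntegral_box hUper hSo.measurableSet fun y hy k hk => ?_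
          have h1 : ‖fun i => (k i : ℝ)‖ < 1 := by
            have h2 := dist_triangle_right (y + fun i => (k i : ℝ)) y x
            rw [dist_self_add_left] at h2
            linarith [Metric.mem_ball.1 hy.2, Metric.mem_ball.1 hk.2]
          funext i
          have h3 := (norm_le_pi_norm (fun i => (k i : ℝ)) i).trans_lt h1
          rw [Real.norm_eq_abs] at h3
          exact Int.abs_lt_one_iff.1 (by exact_mod_cast h3)
      _ = 0 := by
          rw [lintegral_eq_zero_iff (measurable_one.indicator hUo.measurableSet)]
          filter_upwards [hae] with y hy
          simp [hU, hy]
  exact hle.not_gt (hSo.measure_pos _ ⟨x, hx, Metric.mem_ball_self (by norm_num)⟩)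

lemma lintegral_ofReal_rpow_le {α : Type*} [MeasurableSpace α] {μ : Measure α} {p M : ℝ}
    (hp : 0 < p) {g : α → ℝ} (hg : ∀ x, 0 ≤ g x)
    (h : eLpNorm g (ENNReal.ofReal p) μ ≤ ENNReal.ofReal M) :
    ∫⁻ x, ENNReal.ofReal (g x ^ p) ∂μ ≤ ENNReal.ofReal M ^ p := by
  have hne : ENNReal.ofReal p ≠ 0 := by rwa [Ne, ENNReal.ofReal_eq_zero, not_le]
  rw [eLpNorm_eq_lintegral_rpow_enorm_toReal hne ENNReal.ofReal_ne_top,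
    ENNReal.toReal_ofReal hp.le, one_div, ENNReal.rpow_inv_le_iff hp] at h
  refine le_of_eq_of_le (lintegral_congr fun x => ?_) h
  rw [Real.enorm_of_nonneg (hg x), ENNReal.ofReal_rpow_of_nonneg (hg x) hp.le]

/-- Propagation of logarithmic regularity, in terms of squared seminorms. -/
lemma exists_logSeminormSqB_le {d : ℕ} (hd : 1 ≤ d) {p : ℝ} (hp : 1 < p) :
    ∃ K : ℝ, 0 < K ∧ ∀ (b : ℝ → (Fin d → ℝ) → (Fin d → ℝ)) (θ : ℝ → (Fin d → ℝ) → ℝ),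
      ContDiff ℝ (⊤ : ℕ∞) (fun q : ℝ × (Fin d → ℝ) => b q.1 q.2) →
      ContDiff ℝ (⊤ : ℕ∞) (fun q : ℝ × (Fin d → ℝ) => θ q.1 q.2) →
      (∀ t, IsPeriodic (b t)) → (∀ t, IsPeriodic (θ t)) →
      (∀ t x, ∑ i, fderiv ℝ (fun y => b t y i) x (Pi.single i 1) = 0) →
      (∀ t x, deriv (fun s => θ s x) t +
        ∑ i, b t x i * fderiv ℝ (θ t) x (Pi.single i 1) = 0) →
      ∀ (Θ t : ℝ), (∀ x, |θ 0 x| ≤ Θ) → 0 ≤ t →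
        logSeminormSqB d p (θ t) ≤ ENNReal.ofReal K * (ENNReal.ofReal (Θ ^ 2) *
          ENNReal.ofReal (∫ s in (0:ℝ)..t, gradNorm p b s) ^ p + logSeminormSqB d p (θ 0)) := by
  have hp0 : 0 < p := by linarith
  obtain ⟨A, hA, hAw⟩ := exists_lipschitz_weight d hp
  obtain ⟨C, hC, hCw⟩ := exists_logSeminormSqB_comp_le hd hp
  refine ⟨2 * C * ((2 * A) ^ p + 2), by positivity,
    fun b θ hb hθ hbper hθper hdiv heq Θ t hΘ ht => ?_⟩
  obtain ⟨E, -, hE⟩ := exists_transport_error_le hb hθ hbper hθper heq t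
  obtain ⟨D, hD0, hD⟩ := exists_det_error_le hb hbper hdiv t
  obtain ⟨L, hL0, hL, hcont, hint⟩ := exists_mul_gradNorm_le hp hb hbper t
  have hθ0 : Continuous (θ 0) := hθ.continuous.comp (by fun_prop : Continuous fun x => ((0:ℝ), x))
  set I := ∫ s in (0:ℝ)..t, gradNorm p b s with hI
  have hI0 : 0 ≤ I := intervalIntegral.integral_nonneg ht fun u _ => gradNorm_nonneg p b u
  set S₀ := logSeminormSqB d p (θ 0)
  have hdiv0 (c : ℝ) : Filter.Tendsto (fun n : ℕ => c / n) Filter.atTop (nhds 0) :=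
    tendsto_const_div_atTop_nhds_zero_nat c
  have hR : Filter.Tendsto (fun n : ℕ => ENNReal.ofReal C * (ENNReal.ofReal (Θ ^ 2) *
      ENNReal.ofReal (2 * (A * (I + L * t ^ 2 / n))) ^ p + ENNReal.ofReal 2 * S₀)) Filter.atTop
      (nhds (ENNReal.ofReal C * (ENNReal.ofReal (Θ ^ 2) *
        ENNReal.ofReal (2 * (A * I)) ^ p + ENNReal.ofReal 2 * S₀))) := by
    have h1 : Filter.Tendsto (fun n : ℕ => 2 * (A * (I + L * t ^ 2 / n))) Filter.atTop
        (nhds (2 * (A * I))) := by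
      simpa using (((hdiv0 (L * t ^ 2)).const_add I).const_mul A).const_mul 2
    exact ENNReal.Tendsto.const_mul (((ENNReal.Tendsto.const_mul
      ((ENNReal.continuous_rpow_const.tendsto _).comp (ENNReal.tendsto_ofReal h1))
      (Or.inr ENNReal.ofReal_ne_top)).add tendsto_const_nhds)) (Or.inr ENNReal.ofReal_ne_top)
  refine (logSeminormSqB_le_of_tendsto hd hp (hdiv0 (E * t ^ 2)) hR ?_).trans ?_
  · have hexp : Filter.Tendsto (fun n : ℕ => Real.exp (2 * D * t ^ 2 / n)) Filter.atTop
        (nhds 1) := by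
      simpa [Function.comp_def] using (Real.continuous_exp.tendsto 0).comp (hdiv0 (2 * D * t ^ 2))
    filter_upwards [(hdiv0 (t * L)).eventually_lt_const one_pos,
      (hdiv0 (D * t ^ 2)).eventually_le_const (by norm_num : (0:ℝ) < 1 / 2),
      hexp.eventually_le_const _root_.one_lt_two, Filter.eventually_ge_atTop 1] with n h1 h2 h3 hn
    have hn1 : (1:ℝ) ≤ n := by exact_mod_cast hn
    have hn0 : (n:ℝ) ≠ 0 := by positivity
    have hnt : n * (t / n) = t := by field_simp
    have hnc (c : ℝ) : n * (c * (t / n) ^ 2) = c * t ^ 2 / n := by field_simp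
    obtain ⟨Y, g, hY, hθY⟩ := exists_euler_approx hp hA.le hAw hb hbper hL0 hE hD0 hD hL hcont hint
      (ε := t / n) (by positivity) (by rwa [div_mul_eq_mul_div])
      (by
        refine le_trans ?_ h2
        rw [← hnc]
        exact le_mul_of_one_le_left (by positivity) hn1) n hnt.le
    rw [hnt, hnc, ← hI] at hY
    rw [hnt, hnc] at hθY
    have hJ : (1 + 2 * (D * (t / n) ^ 2)) ^ n ≤ 2 := by
      refine le_trans ?_ h3
      rw [← hnc, Real.exp_nat_mul, ← mul_assoc]
      gcongr
      rw [add_comm]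
      exact Real.add_one_le_exp _
    have hY' := hY.mono hJ (mul_le_mul_of_nonneg_right hJ (by positivity))
    refine ⟨fun x => θ 0 (Y x), hθ0.measurable.comp hY.measurable, hθY, ?_⟩
    refine (hCw (θ 0) Y g Θ 2 hθ0.measurable (hθper 0) hΘ hY'.measurable hY'.map_add_int
      hY'.measurable_weight hY'.weight_nonneg hY'.weight_periodic hY'.norm_sub_le
      hY'.lintegral_comp_le).trans ?_
    gcongr
    exact lintegral_ofReal_rpow_le hp0 hY'.weight_nonneg hY'.eLpNorm_le
  · rw [← mul_assoc 2 A I, ENNReal.ofReal_mul (by positivity), ENNReal.mul_rpow_of_nonneg _ _ hp0.le,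
      ENNReal.ofReal_rpow_of_nonneg (by positivity) hp0.le, ENNReal.ofReal_mul (by positivity),
      ENNReal.ofReal_mul two_pos.le, ENNReal.ofReal_ofNat]
    have h1 : ENNReal.ofReal ((2 * A) ^ p) ≤ ENNReal.ofReal ((2 * A) ^ p + 2) := by
      gcongr; linarith
    have h2 : 2 ≤ ENNReal.ofReal ((2 * A) ^ p + 2) := by
      rw [← ENNReal.ofReal_ofNat]
      gcongr
      have : 0 ≤ (2 * A) ^ p := by positivity
      linarith
    generalize ENNReal.ofReal ((2 * A) ^ p + 2) = B at *
    generalize ENNReal.ofReal ((2 * A) ^ p) = B' at *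
    calc _ ≤ 2 * (ENNReal.ofReal C * (ENNReal.ofReal (Θ ^ 2) * (B * ENNReal.ofReal I ^ p) +
          B * S₀)) := by gcongr
      _ = _ := by ring

theorem stmt11 (d : ℕ) (hd : 1 ≤ d) (p : ℝ) (hp : 1 < p) (T : ℝ) (hT : 0 < T) :
    ∃ C : ℝ, 0 < C ∧
      ∀ b : ℝ → (Fin d → ℝ) → (Fin d → ℝ), ∀ θ : ℝ → (Fin d → ℝ) → ℝ,
        ContDiff ℝ (⊤ : ℕ∞) (fun q : ℝ × (Fin d → ℝ) => b q.1 q.2) →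
        ContDiff ℝ (⊤ : ℕ∞) (fun q : ℝ × (Fin d → ℝ) => θ q.1 q.2) →
        (∀ t, IsPeriodic (b t)) → (∀ t, IsPeriodic (θ t)) →
        (∀ t x, ∑ i, fderiv ℝ (fun y => b t y i) x (Pi.single i 1) = 0) →
        (∀ t x, deriv (fun s => θ s x) t +
          ∑ i, b t x i * fderiv ℝ (θ t) x (Pi.single i 1) = 0) →
        ∀ t ∈ Set.Icc (0:ℝ) T,
          logSeminormB d p (θ t) ≤ ENNReal.ofReal C *
            (ENNReal.ofReal
              ((∫ s in (0:ℝ)..t, (eLpNorm (fun x => ‖fderiv ℝ (b s) x‖) (ENNReal.ofReal p)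
                  (volume.restrict (box d))).toReal) ^ (p/2) *
                (eLpNorm (θ 0) ∞ (volume.restrict (box d))).toReal) +
              logSeminormB d p (θ 0)) := by
  obtain ⟨K, hK, hKw⟩ := exists_logSeminormSqB_le hd hp
  refine ⟨K ^ (1 / 2 : ℝ), by positivity, fun b θ hb hθ hbper hθper hdiv heq t ht => ?_⟩
  change _ ≤ _ * (ENNReal.ofReal ((∫ s in (0:ℝ)..t, gradNorm p b s) ^ (p / 2) * _) + _)
  set I := ∫ s in (0:ℝ)..t, gradNorm p b s
  have hI0 : 0 ≤ I := intervalIntegral.integral_nonneg ht.1 fun u _ => gradNorm_nonneg p b u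
  have hθ0 : Continuous (θ 0) := hθ.continuous.comp (by fun_prop : Continuous fun x => ((0:ℝ), x))
  set Θ := (eLpNorm (θ 0) ∞ (volume.restrict (box d))).toReal
  have hΘ0 : 0 ≤ Θ := ENNReal.toReal_nonneg
  have hsq : ENNReal.ofReal (Θ ^ 2) * ENNReal.ofReal I ^ p =
      ENNReal.ofReal (I ^ (p / 2) * Θ) ^ (2:ℝ) := by
    rw [ENNReal.ofReal_rpow_of_nonneg hI0 (by linarith), ← ENNReal.ofReal_mul (by positivity),
      ENNReal.ofReal_rpow_of_nonneg (by positivity) two_pos.le, Real.mul_rpow (by positivity) hΘ0,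
      ← Real.rpow_mul hI0, div_mul_cancel₀ _ two_ne_zero, Real.rpow_two, mul_comm]
  have key := hKw b θ hb hθ hbper hθper hdiv heq Θ t
    ((hθper 0).abs_le_eLpNorm_top hθ0) ht.1
  rw [hsq] at key
  calc logSeminormB d p (θ t) ≤ _ := ENNReal.rpow_le_rpow key (by norm_num)
    _ = ENNReal.ofReal (K ^ (1 / 2 : ℝ)) * (ENNReal.ofReal (I ^ (p / 2) * Θ) ^ (2:ℝ) +
        logSeminormSqB d p (θ 0)) ^ (1 / 2 : ℝ) := by
        rw [ENNReal.mul_rpow_of_nonneg _ _ (by norm_num),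
          ENNReal.ofReal_rpow_of_nonneg hK.le (by norm_num)]
    _ ≤ _ := by
        gcongr
        refine (ENNReal.rpow_add_le_add_rpow _ _ (by norm_num) (by norm_num)).trans ?_
        rw [← ENNReal.rpow_mul, mul_one_div_cancel two_ne_zero, ENNReal.rpow_one]
        rfl
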